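/- (Embedding into Musielak–Orlicz Lebesgue spaces, coercive potential.) Assume condition (D), let V ∈ L¹_loc(ℝ^N) satisfy ess inf_{ℝ^N} V > 0, and let r, s : ℝ^N → ℝ be continuous and bounded with p(x) ≤ r(x) ≤ p*(x) and q(x) ≤ s(x) ≤ q*(x) for all x. Set F(x,t) := t^{r(x)} + a(x)^{s(x)/q(x)} t^{s(x)}. Then there exists C > 0 such that for every u ∈ C_c^∞(ℝ^N): ‖u‖_{L^F(ℝ^N)} ≤ C ‖u‖_{W^{1,H}(ℝ^N)} and ‖u‖_{W^{1,H}(ℝ^N)} ≤ C ‖u‖, where ‖u‖ := inf{τ > 0 : ρ_V(u/τ) ≤ 1}. -/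

import Mathlib

open MeasureTheory Filter
open scoped ENNReal

/-- The double phase integrand `H(x,t) = t^{p(x)} + a(x) t^{q(x)}`. -/
noncomputable def Hfun {N : ℕ} (p q a : EuclideanSpace ℝ (Fin N) → ℝ)
    (x : EuclideanSpace ℝ (Fin N)) (t : ℝ) : ℝ :=
  t ^ p x + a x * t ^ q x

/-- The modular `ρ_V(u) = ∫_{ℝ^N} [H(x,|∇u|) + V(x) H(x,|u|)] dx`. -/
noncomputable def rhoV {N : ℕ} (p q a V : EuclideanSpace ℝ (Fin N) → ℝ)
    (u : EuclideanSpace ℝ (Fin N) → ℝ) : ℝ≥0∞ :=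
  ∫⁻ x, (ENNReal.ofReal (Hfun p q a x ‖gradient u x‖) +
    ENNReal.ofReal (V x * Hfun p q a x |u x|))

/-- The Luxemburg norm `‖u‖ = inf {τ > 0 : ρ_V(u/τ) ≤ 1}` associated with `ρ_V`. -/
noncomputable def VNorm {N : ℕ} (p q a V : EuclideanSpace ℝ (Fin N) → ℝ)
    (u : EuclideanSpace ℝ (Fin N) → ℝ) : ℝ :=
  sInf {τ : ℝ | 0 < τ ∧
    (∫⁻ x, (ENNReal.ofReal (Hfun p q a x (‖gradient u x‖ / τ)) +
      ENNReal.ofReal (V x * Hfun p q a x (|u x| / τ)))) ≤ 1}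

/-- The Luxemburg norm `‖u‖_{L^Φ(U)}` of a Musielak integrand `Φ` on a set `U`. -/
noncomputable def luxNormOn {N : ℕ} (Φ : EuclideanSpace ℝ (Fin N) → ℝ → ℝ)
    (U : Set (EuclideanSpace ℝ (Fin N))) (u : EuclideanSpace ℝ (Fin N) → ℝ) : ℝ :=
  sInf {τ : ℝ | 0 < τ ∧ (∫⁻ x in U, ENNReal.ofReal (Φ x (|u x| / τ))) ≤ 1}

/-- The Sobolev Luxemburg norm `‖u‖_{W^{1,H}(U)}`. -/
noncomputable def sobNormOn {N : ℕ} (p q a : EuclideanSpace ℝ (Fin N) → ℝ)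
    (U : Set (EuclideanSpace ℝ (Fin N))) (u : EuclideanSpace ℝ (Fin N) → ℝ) : ℝ :=
  sInf {τ : ℝ | 0 < τ ∧
    (∫⁻ x in U, (ENNReal.ofReal (Hfun p q a x (‖gradient u x‖ / τ)) +
      ENNReal.ofReal (Hfun p q a x (|u x| / τ)))) ≤ 1}

/-- The open cube `Q_{y,ε}` centered at `y` with edges parallel to the axes of length `ε`. -/
def cube {N : ℕ} (y : EuclideanSpace ℝ (Fin N)) (ε : ℝ) : Set (EuclideanSpace ℝ (Fin N)) :=
  {x | ∀ i, |x i - y i| < ε / 2}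

/-- Condition (D): `p, q` bounded Lipschitz with `1 < inf p`, `sup q < N`,
`p < q < N` pointwise, `sup q/p < 1 + 1/N`; `a ≥ 0` bounded Lipschitz. -/
structure CondD (N : ℕ) (p q a : EuclideanSpace ℝ (Fin N) → ℝ) : Prop where
  lip_p : ∃ K : NNReal, LipschitzWith K p
  lip_q : ∃ K : NNReal, LipschitzWith K q
  lip_a : ∃ K : NNReal, LipschitzWith K a
  inf_p : ∃ c > (1 : ℝ), ∀ x, c ≤ p x
  sup_q : ∃ c < (N : ℝ), ∀ x, q x ≤ c
  p_lt_q : ∀ x, p x < q x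
  q_lt_N : ∀ x, q x < N
  ratio : ∃ c < 1 + 1 / (N : ℝ), ∀ x, q x / p x ≤ c
  a_nonneg : ∀ x, 0 ≤ a x
  a_bdd : ∃ C : ℝ, ∀ x, a x ≤ C

section GagliardoNirenberg

variable {G : Type*} [NormedAddCommGroup G] [NormedSpace ℝ G] [FiniteDimensional ℝ G]
  [MeasurableSpace G] [BorelSpace G]

/-- The derivative of a mollified Lipschitz function is bounded by the mollified derivative. -/
lemma enorm_fderiv_normed_convolution_le (μ : Measure G) [μ.IsAddHaarMeasure]
    (φ : ContDiffBump (0 : G)) {v : G → ℝ} {K : NNReal} (hv : LipschitzWith K v) (x : G) :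
    ‖fderiv ℝ (convolution (φ.normed μ) v (ContinuousLinearMap.lsmul ℝ ℝ) μ) x‖ₑ ≤
      ∫⁻ y, ‖φ.normed μ y‖ₑ * ‖fderiv ℝ v (x - y)‖ₑ ∂μ := by
  have hφc : Continuous (φ.normed μ) := (φ.contDiff_normed (n := 0)).continuous
  have hdiff : ∀ᵐ y ∂μ, DifferentiableAt ℝ v (x - y) :=
    (Measure.measurePreserving_sub_left μ x).quasiMeasurePreserving.ae
      (hv.ae_differentiableAt (μ := μ))
  have hF : ∀ z, Continuous fun y => (φ.normed μ y) • v (z - y) := fun z =>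
    hφc.smul (hv.continuous.comp (continuous_const.sub continuous_id))
  have key := hasFDerivAt_integral_of_dominated_loc_of_lip (μ := μ) (𝕜 := ℝ)
    (F := fun z y => (φ.normed μ y) • v (z - y)) (x₀ := x) (s := Set.univ)
    (F' := fun y => (φ.normed μ y) • fderiv ℝ v (x - y))
    (bound := fun y => φ.normed μ y * K) Filter.univ_mem
    (Eventually.of_forall fun z => (hF z).aestronglyMeasurable)
    ((hF x).integrable_of_hasCompactSupport (φ.hasCompactSupport_normed.smul_right))
    (by
      refine (hφc.measurable.smul ?_).aestronglyMeasurable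
      exact (measurable_fderiv ℝ v).comp (measurable_const.sub measurable_id))
    (Eventually.of_forall fun y => by
      refine LipschitzOnWith.of_dist_le_mul fun z _ w _ => ?_
      rw [Real.coe_nnabs, dist_eq_norm, ← smul_sub, norm_smul, abs_mul, mul_assoc,
        NNReal.abs_eq, Real.norm_eq_abs]
      gcongr
      rw [← dist_eq_norm]
      simpa using hv.dist_le_mul (z - y) (w - y))
    (φ.integrable_normed.mul_const _)
    (hdiff.mono fun y hy => by
      have h1 : HasFDerivAt (fun z => v (z - y)) (fderiv ℝ v (x - y)) x := by
        have := hy.hasFDerivAt.comp x ((hasFDerivAt_id (𝕜 := ℝ) x).sub_const y)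
        rwa [ContinuousLinearMap.comp_id] at this
      exact h1.fun_const_smul _)
  have hfd : fderiv ℝ (convolution (φ.normed μ) v (ContinuousLinearMap.lsmul ℝ ℝ) μ) x =
      ∫ y, (φ.normed μ y) • fderiv ℝ v (x - y) ∂μ := key.2.fderiv
  rw [hfd]
  refine (enorm_integral_le_lintegral_enorm _).trans_eq ?_
  simp only [enorm_smul]

/-- Mollification does not increase the total variation of a Lipschitz function. -/
lemma lintegral_enorm_fderiv_normed_convolution_le (μ : Measure G) [μ.IsAddHaarMeasure]
    (φ : ContDiffBump (0 : G)) {v : G → ℝ} {K : NNReal} (hv : LipschitzWith K v) :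
    ∫⁻ x, ‖fderiv ℝ (convolution (φ.normed μ) v (ContinuousLinearMap.lsmul ℝ ℝ) μ) x‖ₑ ∂μ ≤
      ∫⁻ x, ‖fderiv ℝ v x‖ₑ ∂μ := by
  have hφc : Continuous (φ.normed μ) := (φ.contDiff_normed (n := 0)).continuous
  refine (lintegral_mono fun x => enorm_fderiv_normed_convolution_le μ φ hv x).trans ?_
  have hD : Measurable fun x => ‖fderiv ℝ v x‖ₑ := (measurable_fderiv ℝ v).enorm
  rw [lintegral_lintegral_swap]
  · have h1 : ∀ y, ∫⁻ x, ‖φ.normed μ y‖ₑ * ‖fderiv ℝ v (x - y)‖ₑ ∂μ =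
        ‖φ.normed μ y‖ₑ * ∫⁻ x, ‖fderiv ℝ v x‖ₑ ∂μ := fun y => by
      have hDy : Measurable fun x => ‖fderiv ℝ v (x - y)‖ₑ := hD.comp (measurable_id.sub_const y)
      rw [lintegral_const_mul _ hDy,
        lintegral_sub_right_eq_self (μ := μ) (fun x => ‖fderiv ℝ v x‖ₑ) y]
    simp_rw [h1]
    rw [lintegral_mul_const _ hφc.measurable.enorm]
    have h2 : ∫⁻ y, ‖φ.normed μ y‖ₑ ∂μ = 1 := by
      rw [← ofReal_integral_norm_eq_lintegral_enorm φ.integrable_normed]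
      simp_rw [Real.norm_of_nonneg (φ.nonneg_normed _)]
      simp [φ.integral_normed]
    rw [h2, one_mul]
  · refine Measurable.aemeasurable ?_
    exact (hφc.measurable.comp measurable_snd).enorm.mul
      (hD.comp (measurable_fst.sub measurable_snd))

/-- The Gagliardo–Nirenberg–Sobolev inequality for compactly supported Lipschitz functions. -/
lemma lintegral_rpow_le_of_lipschitzWith (μ : Measure G) [μ.IsAddHaarMeasure] {v : G → ℝ}
    {K : NNReal} (hv : LipschitzWith K v) (hvs : HasCompactSupport v) {P : ℝ}
    (hP : Real.HolderConjugate (Module.finrank ℝ G) P) :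
    ∫⁻ x, ‖v x‖ₑ ^ P ∂μ ≤
      lintegralPowLePowLIntegralFDerivConst μ P * (∫⁻ x, ‖fderiv ℝ v x‖ₑ ∂μ) ^ P := by
  have hφ : ∀ n : ℕ, ∃ φ : ContDiffBump (0 : G), φ.rOut = 1 / ((n : ℝ) + 1) := fun n =>
    ⟨⟨1 / ((n : ℝ) + 1) / 2, 1 / ((n : ℝ) + 1), by positivity, half_lt_self (by positivity)⟩, rfl⟩
  choose φ hφr using hφ
  set w : ℕ → G → ℝ := fun n =>
    convolution ((φ n).normed μ) v (ContinuousLinearMap.lsmul ℝ ℝ) μ with hw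
  have hwc : ∀ n, ContDiff ℝ 1 (w n) := fun n =>
    (φ n).hasCompactSupport_normed.contDiff_convolution_left (n := 1) _ (φ n).contDiff_normed
      hv.continuous.locallyIntegrable
  have hws : ∀ n, HasCompactSupport (w n) := fun n =>
    (φ n).hasCompactSupport_normed.convolution _ hvs
  have hlim : ∀ x, Tendsto (fun n => w n x) atTop (nhds (v x)) := fun x =>
    ContDiffBump.convolution_tendsto_right_of_continuous
      (by simpa only [hφr] using tendsto_one_div_add_atTop_nhds_zero_nat) hv.continuous x
  have hbd : ∀ n, ∫⁻ x, ‖w n x‖ₑ ^ P ∂μ ≤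
      lintegralPowLePowLIntegralFDerivConst μ P * (∫⁻ x, ‖fderiv ℝ v x‖ₑ ∂μ) ^ P := fun n => by
    refine (lintegral_pow_le_pow_lintegral_fderiv μ (hwc n) (hws n) hP).trans ?_
    refine mul_le_mul_right (ENNReal.rpow_le_rpow ?_ hP.symm.nonneg) _
    exact lintegral_enorm_fderiv_normed_convolution_le μ (φ n) hv
  calc ∫⁻ x, ‖v x‖ₑ ^ P ∂μ
      = ∫⁻ x, liminf (fun n => ‖w n x‖ₑ ^ P) atTop ∂μ := by
        refine lintegral_congr fun x => (Tendsto.liminf_eq ?_).symm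
        exact ((ENNReal.continuous_rpow_const (y := P)).tendsto _).comp
          ((continuous_enorm.tendsto _).comp (hlim x))
    _ ≤ liminf (fun n => ∫⁻ x, ‖w n x‖ₑ ^ P ∂μ) atTop :=
        lintegral_liminf_le fun n => ((hwc n).continuous.measurable.enorm.pow_const P)
    _ ≤ _ := by
        refine (liminf_le_liminf (Eventually.of_forall hbd)).trans_eq ?_
        simp

end GagliardoNirenberg

section Scalar

lemma rpow_sub_one_mul_le {δ Y R m n : ℝ} (hδ : 0 < δ) (hδ1 : δ ≤ 1) (hY : 0 ≤ Y) (hR : 0 ≤ R)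
    (hm : 1 < m) (hmn : m ≤ n) :
    Y ^ (m - 1) * R ≤ δ * Y ^ m + δ⁻¹ ^ n * R ^ m := by
  have hδi : 1 ≤ δ⁻¹ := (one_le_inv₀ hδ).2 hδ1
  rcases le_total R (δ * Y) with h | h
  · have : Y ^ (m - 1) * R ≤ δ * Y ^ m := by
      calc Y ^ (m - 1) * R ≤ Y ^ (m - 1) * (δ * Y) := by gcongr
        _ = δ * (Y ^ (m - 1) * Y ^ (1 : ℝ)) := by rw [Real.rpow_one]; ring
        _ = δ * Y ^ m := by rw [← Real.rpow_add' hY (by linarith)]; ring_nf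
    have h2 : 0 ≤ δ⁻¹ ^ n * R ^ m := by positivity
    linarith
  · have hYR : Y ≤ δ⁻¹ * R := by rwa [le_inv_mul_iff₀ hδ]
    have : Y ^ (m - 1) * R ≤ δ⁻¹ ^ n * R ^ m := by
      calc Y ^ (m - 1) * R ≤ (δ⁻¹ * R) ^ (m - 1) * R := by
            gcongr
        _ = δ⁻¹ ^ (m - 1) * (R ^ (m - 1) * R ^ (1 : ℝ)) := by
            rw [Real.mul_rpow (by positivity) hR, Real.rpow_one]; ring
        _ = δ⁻¹ ^ (m - 1) * R ^ m := by rw [← Real.rpow_add' hR (by linarith)]; ring_nf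
        _ ≤ δ⁻¹ ^ n * R ^ m := by
            gcongr
            linarith
    have h2 : 0 ≤ δ * Y ^ m := by positivity
    linarith

lemma rpow_sub_one_mul_le_of_lt {δ Y U m n : ℝ} (hδ : 0 < δ) (hδ1 : δ ≤ 1) (hY : 0 ≤ Y)
    (hU : 0 ≤ U) (hm : 1 < m) (hmn : m < n) :
    Y ^ (m - 1) * U ≤ δ * Y ^ n + δ⁻¹ ^ n * U ^ (n / (n - m + 1)) := by
  have hδi : 1 ≤ δ⁻¹ := (one_le_inv₀ hδ).2 hδ1
  have hk : 1 ≤ n - m + 1 := by linarith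
  rcases le_total U (δ * Y ^ (n - m + 1)) with h | h
  · have : Y ^ (m - 1) * U ≤ δ * Y ^ n := by
      calc Y ^ (m - 1) * U ≤ Y ^ (m - 1) * (δ * Y ^ (n - m + 1)) := by gcongr
        _ = δ * (Y ^ (m - 1) * Y ^ (n - m + 1)) := by ring
        _ = δ * Y ^ n := by rw [← Real.rpow_add' hY (by linarith)]; ring_nf
    have h2 : 0 ≤ δ⁻¹ ^ n * U ^ (n / (n - m + 1)) := by positivity
    linarith
  · have hYU : Y ≤ (δ⁻¹ * U) ^ (n - m + 1)⁻¹ := by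
      rw [Real.le_rpow_inv_iff_of_pos hY (by positivity) (by linarith)]
      rwa [le_inv_mul_iff₀ hδ]
    have : Y ^ (m - 1) * U ≤ δ⁻¹ ^ n * U ^ (n / (n - m + 1)) := by
      calc Y ^ (m - 1) * U ≤ ((δ⁻¹ * U) ^ (n - m + 1)⁻¹) ^ (m - 1) * U := by
            gcongr
        _ = δ⁻¹ ^ ((n - m + 1)⁻¹ * (m - 1)) *
              (U ^ ((n - m + 1)⁻¹ * (m - 1)) * U ^ (1 : ℝ)) := by
            rw [← Real.rpow_mul (by positivity), Real.mul_rpow (by positivity) hU,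
              Real.rpow_one]; ring
        _ = δ⁻¹ ^ ((n - m + 1)⁻¹ * (m - 1)) * U ^ (n / (n - m + 1)) := by
            have h0 : 0 < (n - m + 1)⁻¹ * (m - 1) :=
              mul_pos (inv_pos.2 (by linarith)) (by linarith)
            rw [← Real.rpow_add' hU (by linarith)]
            congr 2
            field_simp
            ring
        _ ≤ δ⁻¹ ^ n * U ^ (n / (n - m + 1)) := by
            gcongr
            calc (n - m + 1)⁻¹ * (m - 1) ≤ 1 * (m - 1) := by
                  gcongr
                  exact inv_le_one_of_one_le₀ hk
              _ ≤ n := by linarith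
    have h2 : 0 ≤ δ * Y ^ n := by positivity
    linarith

lemma rpow_sub_one_mul_abs_log_le {δ Y c m n : ℝ} (hδ : 0 < δ) (hY : 0 < Y)
    (hc : 1 < c) (hcm : c ≤ m) (hmn : m < n) :
    Y ^ (n - 1) * |Real.log Y| ≤ δ * Y ^ n + (1 / (c - 1) + (4 / δ ^ 2) ^ n) * Y ^ (n - m) := by
  have hZ : 0 ≤ Y ^ (n - m) := by positivity
  have hA : 0 ≤ δ * Y ^ n := by positivity
  have hB : 0 ≤ (4 / δ ^ 2) ^ n * Y ^ (n - m) := by positivity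
  have hC : 0 ≤ 1 / (c - 1) * Y ^ (n - m) := mul_nonneg (by simp; linarith) hZ
  rcases le_total Y 1 with h1 | h1
  · have h2 := (Real.abs_log_mul_self_rpow_lt Y (c - 1) hY h1 (by linarith)).le
    have : Y ^ (n - 1) * |Real.log Y| ≤ 1 / (c - 1) * Y ^ (n - m) := by
      calc Y ^ (n - 1) * |Real.log Y| = Y ^ (n - m) * (Y ^ (m - 1) * |Real.log Y|) := by
            rw [← mul_assoc, ← Real.rpow_add hY]; ring_nf
        _ ≤ Y ^ (n - m) * (Y ^ (c - 1) * |Real.log Y|) := by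
            have : Y ^ (m - 1) ≤ Y ^ (c - 1) :=
              Real.rpow_le_rpow_of_exponent_ge hY h1 (by linarith)
            gcongr
        _ = Y ^ (n - m) * |Real.log Y * Y ^ (c - 1)| := by
            rw [abs_mul, abs_of_nonneg (Real.rpow_nonneg hY.le (c - 1))]; ring
        _ ≤ Y ^ (n - m) * (1 / (c - 1)) := by gcongr
        _ = _ := by ring
    linarith
  · have hl : 0 ≤ Real.log Y := Real.log_nonneg h1
    rw [abs_of_nonneg hl]
    rcases le_total (Real.log Y) (δ * Y) with h | h
    · have : Y ^ (n - 1) * Real.log Y ≤ δ * Y ^ n := by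
        calc Y ^ (n - 1) * Real.log Y ≤ Y ^ (n - 1) * (δ * Y) := by gcongr
          _ = δ * (Y ^ (n - 1) * Y ^ (1 : ℝ)) := by rw [Real.rpow_one]; ring
          _ = δ * Y ^ n := by rw [← Real.rpow_add hY]; ring_nf
      linarith
    · have hY4 : Y ≤ 4 / δ ^ 2 := by
        have h3 : Real.log Y ≤ 2 * √Y := by
          have := Real.log_le_rpow_div hY.le (ε := 1 / 2) (by norm_num)
          rw [← Real.sqrt_eq_rpow] at this
          linarith
        have h4 : 0 < √Y := Real.sqrt_pos.2 hY
        have h5 : √Y * √Y = Y := Real.mul_self_sqrt hY.le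
        have h6 : δ * √Y ≤ 2 := by
          by_contra! h7
          nlinarith
        rw [le_div_iff₀ (by positivity)]
        have h8 : 0 ≤ δ * √Y := by positivity
        calc Y * δ ^ 2 = (δ * √Y) * (δ * √Y) := by rw [← h5]; ring_nf; simp; ring
          _ ≤ 4 := by nlinarith
      have : Y ^ (n - 1) * Real.log Y ≤ (4 / δ ^ 2) ^ n * Y ^ (n - m) := by
        calc Y ^ (n - 1) * Real.log Y ≤ Y ^ (n - 1) * Y := by
              gcongr
              exact (Real.log_le_sub_one_of_pos hY).trans (by linarith)
          _ = Y ^ (n - 1) * Y ^ (1 : ℝ) := by rw [Real.rpow_one]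
          _ = Y ^ m * Y ^ (n - m) := by rw [← Real.rpow_add hY, ← Real.rpow_add hY]; ring_nf
          _ ≤ Y ^ n * Y ^ (n - m) := by
              gcongr
          _ ≤ (4 / δ ^ 2) ^ n * Y ^ (n - m) := by
              gcongr
              linarith
      linarith

/-- Interpolation of the intermediate power between `n - m` and `n` with a small top-order term. -/
lemma rpow_intermediate_le {δ Y m n : ℝ} (hδ : 0 < δ) (hδ1 : δ ≤ 1) (hY : 0 ≤ Y)
    (hm : 1 < m) (hmn : m < n) :
    Y ^ ((n - m) * (n / (n - m + 1))) ≤ δ * Y ^ n + δ⁻¹ ^ n * Y ^ (n - m) := by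
  have hk : 0 < n - m + 1 := by linarith
  have hn : 0 < n := by linarith
  have hs : (n - m) * (n / (n - m + 1)) - (n - m) = (n - m) * (m - 1) / (n - m + 1) := by
    field_simp; ring
  have hs' : n - (n - m) * (n / (n - m + 1)) = n / (n - m + 1) := by field_simp; ring
  have h1 : 1 < n / (n - m + 1) := by rw [lt_div_iff₀ hk]; linarith
  have h0 : 0 < (n - m) * (m - 1) / (n - m + 1) := by
    have : 0 < m - 1 := by linarith
    have : 0 < n - m := by linarith
    positivity
  have hδi : 1 ≤ δ⁻¹ := (one_le_inv₀ hδ).2 hδ1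
  have hA : 0 ≤ δ * Y ^ n := by positivity
  have hB : 0 ≤ δ⁻¹ ^ n * Y ^ (n - m) := by positivity
  rcases le_total Y δ⁻¹ with h | h
  · have : Y ^ ((n - m) * (n / (n - m + 1))) ≤ δ⁻¹ ^ n * Y ^ (n - m) := by
      calc Y ^ ((n - m) * (n / (n - m + 1)))
          = Y ^ ((n - m) * (m - 1) / (n - m + 1)) * Y ^ (n - m) := by
            rw [← Real.rpow_add' hY (by linarith), ← hs]; ring_nf
        _ ≤ δ⁻¹ ^ ((n - m) * (m - 1) / (n - m + 1)) * Y ^ (n - m) := by gcongr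
        _ ≤ δ⁻¹ ^ n * Y ^ (n - m) := by
            gcongr
            linarith
    linarith
  · have hY1 : 1 ≤ Y := hδi.trans h
    have hY0 : 0 < Y := by linarith
    have : Y ^ ((n - m) * (n / (n - m + 1))) ≤ δ * Y ^ n := by
      calc Y ^ ((n - m) * (n / (n - m + 1))) ≤ Y ^ (n - 1) := by
            gcongr
            linarith
        _ = 1 * Y ^ (n - 1) := by ring
        _ ≤ (δ * Y) * Y ^ (n - 1) := by
            gcongr
            rwa [inv_le_iff_one_le_mul₀' hδ] at h
        _ = δ * (Y ^ (1 : ℝ) * Y ^ (n - 1)) := by rw [Real.rpow_one]; ring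
        _ = δ * Y ^ n := by rw [← Real.rpow_add hY0]; ring_nf
    linarith

lemma abs_rpow_sub_rpow_le {B M k s t : ℝ} (hB : 1 ≤ B) (hk : 1 ≤ k) (hkM : k ≤ M)
    (hs : s ∈ Set.Icc 0 B) (ht : t ∈ Set.Icc 0 B) :
    |s ^ k - t ^ k| ≤ M * B ^ M * |s - t| := by
  refine (convex_Icc 0 B).norm_image_sub_le_of_norm_hasDerivWithin_le
    (f := fun y => y ^ k) (f' := fun y => k * y ^ (k - 1)) (fun y _ =>
      (Real.hasDerivAt_rpow_const (Or.inr hk)).hasDerivWithinAt) (fun y hy => ?_) ht hs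
  have hy0 : 0 ≤ y := hy.1
  rw [Real.norm_of_nonneg (by positivity)]
  calc k * y ^ (k - 1) ≤ M * B ^ (k - 1) := by
        gcongr
        · linarith
        · exact hy.2
    _ ≤ M * B ^ M := by
        gcongr
        · linarith
        · linarith

lemma abs_rpow_sub_rpow_exponent_le {B M k l t : ℝ} (hB : 1 ≤ B) (hk : k ∈ Set.Icc 1 M)
    (hl : l ∈ Set.Icc 1 M) (ht0 : 0 ≤ t) (htB : t ≤ B) :
    |t ^ k - t ^ l| ≤ B ^ (M + 1) * |k - l| := by
  rcases ht0.eq_or_lt with rfl | ht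
  · rw [Real.zero_rpow (by linarith [hk.1]), Real.zero_rpow (by linarith [hl.1])]
    simp only [sub_self, abs_zero]
    positivity
  refine (convex_Icc 1 M).norm_image_sub_le_of_norm_hasDerivWithin_le
    (f := fun y => t ^ y) (f' := fun y => t ^ y * Real.log t) (fun y _ => by
      simpa using ((Real.hasStrictDerivAt_const_rpow ht y).hasDerivAt).hasDerivWithinAt)
    (fun y hy => ?_) hl hk
  rw [Real.norm_eq_abs, abs_mul, abs_of_nonneg (by positivity)]
  have hM : 1 ≤ M := hk.1.trans hk.2
  rcases le_total t 1 with h | h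
  · calc t ^ y * |Real.log t| ≤ t ^ (1 : ℝ) * |Real.log t| := by
          gcongr ?_ * _
          exact Real.rpow_le_rpow_of_exponent_ge ht h hy.1
      _ = |Real.log t * t| := by rw [abs_mul, abs_of_pos ht, Real.rpow_one, mul_comm]
      _ ≤ 1 := (Real.abs_log_mul_self_lt t ht h).le
      _ ≤ B ^ (M + 1) := Real.one_le_rpow hB (by linarith)
  · rw [abs_of_nonneg (Real.log_nonneg h)]
    calc t ^ y * Real.log t ≤ t ^ M * t ^ (1 : ℝ) := by
          rw [Real.rpow_one]
          gcongr
          · exact Real.log_nonneg h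
          · exact hy.2
          · exact (Real.log_le_sub_one_of_pos ht).trans (by linarith)
      _ = t ^ (M + 1) := by rw [← Real.rpow_add ht]
      _ ≤ B ^ (M + 1) := by gcongr

end Scalar

section Lipschitz

variable {G : Type*} [PseudoMetricSpace G]

/-- A variable power with Lipschitz base and Lipschitz exponent at least one is Lipschitz. -/
lemma exists_lipschitzWith_rpow {f k : G → ℝ} {K L : NNReal} {B M : ℝ} (hf : LipschitzWith L f)
    (hk : LipschitzWith K k) (hf0 : ∀ x, 0 ≤ f x) (hfB : ∀ x, f x ≤ B) (hk1 : ∀ x, 1 ≤ k x)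
    (hkM : ∀ x, k x ≤ M) : ∃ C : NNReal, LipschitzWith C fun x => f x ^ k x := by
  have hB1 : 1 ≤ max B 1 := le_max_right _ _
  set B' := max B 1 with hB'
  have hfB' : ∀ x, f x ≤ B' := fun x => (hfB x).trans (le_max_left _ _)
  refine ⟨Real.toNNReal (M * B' ^ M * L + B' ^ (M + 1) * K),
    LipschitzWith.of_dist_le_mul fun x y => ?_⟩
  have hM : 0 ≤ M := by linarith [hk1 x, hkM x]
  rw [Real.coe_toNNReal _ (by positivity), Real.dist_eq]
  have h1 := abs_rpow_sub_rpow_le hB1 (hk1 x) (hkM x) ⟨hf0 x, hfB' x⟩ ⟨hf0 y, hfB' y⟩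
  have h2 := abs_rpow_sub_rpow_exponent_le hB1 ⟨hk1 x, hkM x⟩ ⟨hk1 y, hkM y⟩ (hf0 y) (hfB' y)
  have h3 := hf.dist_le_mul x y
  have h4 := hk.dist_le_mul x y
  rw [Real.dist_eq] at h3 h4
  calc |f x ^ k x - f y ^ k y| ≤ |f x ^ k x - f y ^ k x| + |f y ^ k x - f y ^ k y| :=
        abs_sub_le _ _ _
    _ ≤ M * B' ^ M * (L * dist x y) + B' ^ (M + 1) * (K * dist x y) := by
        refine add_le_add (h1.trans ?_) (h2.trans ?_) <;> gcongr
    _ = _ := by ring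

lemma exists_lipschitzWith_mul {f g : G → ℝ} {K L : NNReal} {A B : ℝ} (hf : LipschitzWith L f)
    (hg : LipschitzWith K g) (hfA : ∀ x, |f x| ≤ A) (hgB : ∀ x, |g x| ≤ B) :
    ∃ C : NNReal, LipschitzWith C fun x => f x * g x := by
  refine ⟨Real.toNNReal (A * K + B * L), LipschitzWith.of_dist_le_mul fun x y => ?_⟩
  have hA : 0 ≤ A := (abs_nonneg _).trans (hfA x)
  have hB : 0 ≤ B := (abs_nonneg _).trans (hgB x)
  rw [Real.coe_toNNReal _ (by positivity), Real.dist_eq]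
  have h3 := hf.dist_le_mul x y
  have h4 := hg.dist_le_mul x y
  rw [Real.dist_eq] at h3 h4
  calc |f x * g x - f y * g y| = |f x * (g x - g y) + g y * (f x - f y)| := by ring_nf
    _ ≤ |f x| * |g x - g y| + |g y| * |f x - f y| := by
        rw [← abs_mul, ← abs_mul]; exact abs_add_le _ _
    _ ≤ A * (K * dist x y) + B * (L * dist x y) := by
        gcongr
        exacts [hfA x, hgB y]
    _ = _ := by ring

end Lipschitz

section Pointwise

lemma mul_abs_log_le {b B : ℝ} (hb : 0 < b) (hB : b ≤ B) : b * |Real.log b| ≤ 1 + B ^ 2 := by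
  rcases le_total b 1 with h | h
  · have := (Real.abs_log_mul_self_lt b hb h).le
    rw [abs_mul, abs_of_pos hb, mul_comm] at this
    nlinarith [sq_nonneg B]
  · rw [abs_of_nonneg (Real.log_nonneg h)]
    have := Real.log_le_sub_one_of_pos hb
    nlinarith

/-- The absorption estimate behind the critical Sobolev inequality with variable exponent `m` and
weight `b`. -/
lemma exists_weighted_absorption {n c d B E K L δ : ℝ} (hc : 1 < c) (hd : d < n)
    (hE : 0 ≤ E) (hK : 0 ≤ K) (hL : 0 ≤ L) (hδ : 0 < δ) :
    ∃ C : ℝ, 0 ≤ C ∧ ∀ m b t D : ℝ, c ≤ m → m ≤ d → 0 < b → b ≤ B → 0 < t → 0 ≤ D →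
      (b * t ^ m) ^ ((n - 1) / (n - m)) *
        (E * |Real.log (b * t ^ m)| +
          (n - 1) / (n - m) * (L / b + K * |Real.log t| + m * (D / t))) ≤
      δ * (b * t ^ m) ^ (n / (n - m)) +
        C * (b * D ^ m + b * t ^ m + (t ^ m) ^ (n / (n - m + 1))) := by
  rcases lt_or_ge d c with hdc | hcd
  · exact ⟨0, le_rfl, fun m b t D h1 h2 => absurd (h1.trans h2) (not_le.2 hdc)⟩
  have hn : 1 < n := by linarith
  set A : ℝ := (n - 1) / (n - d) with hA
  have hA0 : 0 ≤ A := div_nonneg (by linarith) (by linarith)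
  set C₁ : ℝ := (E * n + A * K * n) + A * (L + K * (1 + B ^ 2)) + A * n + 1 with hC₁
  have hp1 : 0 ≤ E * n + A * K * n := by positivity
  have hp2 : 0 ≤ A * (L + K * (1 + B ^ 2)) := by positivity
  have hp3 : 0 ≤ A * n := by positivity
  have hC₁0 : 0 < C₁ := by linarith
  set η : ℝ := min 1 (δ / (3 * C₁)) with hη
  have hη0 : 0 < η := lt_min one_pos (by positivity)
  have hη1 : η ≤ 1 := min_le_left _ _
  have hηδ : C₁ * (3 * η) ≤ δ := by
    have : η ≤ δ / (3 * C₁) := min_le_right _ _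
    rw [le_div_iff₀ (by positivity)] at this
    linarith
  set C₂ : ℝ := 1 / (c - 1) + (4 / η ^ 2) ^ n with hC₂
  have hC₂0 : 0 ≤ C₂ := by
    have : 0 < c - 1 := by linarith
    positivity
  set C₃ : ℝ := η⁻¹ ^ n with hC₃
  have hC₃0 : 0 ≤ C₃ := by positivity
  refine ⟨C₁ * (C₂ + C₃), by positivity, fun m b t D hcm hmd hb hbB ht hD => ?_⟩
  have hm1 : 1 < m := by linarith
  have hmn : m < n := by linarith
  have hnm : 0 < n - m := by linarith
  have hz : 0 < b * t ^ m := by positivity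
  set Y : ℝ := (b * t ^ m) ^ (n - m)⁻¹ with hY
  have hY0 : 0 < Y := by positivity
  have hYz : Y ^ (n - m) = b * t ^ m := by
    rw [hY, ← Real.rpow_mul hz.le, inv_mul_cancel₀ hnm.ne', Real.rpow_one]
  have hYpow : ∀ k : ℝ, (b * t ^ m) ^ (k / (n - m)) = Y ^ k := fun k => by
    rw [hY, ← Real.rpow_mul hz.le]; congr 1; field_simp
  have hsplit : Y ^ (n - 1) = Y ^ (m - 1) * (b * t ^ m) := by
    rw [← hYz, ← Real.rpow_add hY0]; ring_nf
  have hsplit' : Y ^ n = (b * t ^ m) * Y ^ m := by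
    rw [← hYz, ← Real.rpow_add hY0]; ring_nf
  have hlogz : |Real.log (b * t ^ m)| ≤ n * |Real.log Y| := by
    rw [← hYz, Real.log_rpow hY0, abs_mul, abs_of_pos hnm]
    gcongr
    linarith
  have hlogt : |Real.log t| ≤ n * |Real.log Y| + |Real.log b| := by
    have h1 : m * Real.log t = Real.log (b * t ^ m) - Real.log b := by
      rw [Real.log_mul hb.ne' (by positivity), Real.log_rpow ht]; ring
    calc |Real.log t| = 1 * |Real.log t| := by ring
      _ ≤ m * |Real.log t| := by gcongr
      _ = |m * Real.log t| := by rw [abs_mul, abs_of_pos (by linarith : 0 < m)]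
      _ ≤ |Real.log (b * t ^ m)| + |Real.log b| := by rw [h1]; exact abs_sub _ _
      _ ≤ _ := by gcongr
  have hAe : (n - 1) / (n - m) ≤ A := by
    rw [hA]
    gcongr
  set a₁ := Y ^ (n - 1) * |Real.log Y| with ha₁
  set a₂ := Y ^ (m - 1) * t ^ m with ha₂
  set a₃ := Y ^ (n - 1) * (D / t) with ha₃
  have ha₁0 : 0 ≤ a₁ := by positivity
  have ha₂0 : 0 ≤ a₂ := by positivity
  have ha₃0 : 0 ≤ a₃ := by positivity
  have hb1 : Y ^ (n - 1) * (L / b) = L * a₂ := by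
    rw [hsplit, ha₂]; field_simp
  have hb2 : Y ^ (n - 1) * |Real.log b| ≤ (1 + B ^ 2) * a₂ := by
    calc Y ^ (n - 1) * |Real.log b| = a₂ * (b * |Real.log b|) := by rw [hsplit, ha₂]; ring
      _ ≤ a₂ * (1 + B ^ 2) := by
          gcongr
          exact mul_abs_log_le hb hbB
      _ = _ := by ring
  have he0 : 0 ≤ (n - 1) / (n - m) := div_nonneg (by linarith) hnm.le
  have hmain : Y ^ (n - 1) * (E * |Real.log (b * t ^ m)| +
      (n - 1) / (n - m) * (L / b + K * |Real.log t| + m * (D / t))) ≤ C₁ * (a₁ + a₂ + a₃) := by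
    calc Y ^ (n - 1) * (E * |Real.log (b * t ^ m)| +
          (n - 1) / (n - m) * (L / b + K * |Real.log t| + m * (D / t)))
        ≤ Y ^ (n - 1) * (E * (n * |Real.log Y|) +
          A * (L / b + K * (n * |Real.log Y| + |Real.log b|) + n * (D / t))) := by
          gcongr
      _ = (E * n + A * K * n) * a₁ + A * (Y ^ (n - 1) * (L / b)) +
            A * K * (Y ^ (n - 1) * |Real.log b|) + A * n * a₃ := by rw [ha₁, ha₃]; ring
      _ ≤ (E * n + A * K * n) * a₁ + A * (L * a₂) + A * K * ((1 + B ^ 2) * a₂) +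
            A * n * a₃ := by
          rw [hb1]
          gcongr
      _ = (E * n + A * K * n) * a₁ + A * (L + K * (1 + B ^ 2)) * a₂ + A * n * a₃ := by ring
      _ ≤ C₁ * a₁ + C₁ * a₂ + C₁ * a₃ := by
          gcongr <;> linarith
      _ = _ := by ring
  have h1 : a₁ ≤ η * Y ^ n + C₂ * (b * t ^ m) := by
    have := rpow_sub_one_mul_abs_log_le hη0 hY0 hc hcm hmn
    rwa [hYz] at this
  have h2 : a₂ ≤ η * Y ^ n + C₃ * (t ^ m) ^ (n / (n - m + 1)) :=
    rpow_sub_one_mul_le_of_lt hη0 hη1 hY0.le (by positivity) hm1 hmn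
  have h3 : a₃ ≤ η * Y ^ n + C₃ * (b * D ^ m) := by
    have h := rpow_sub_one_mul_le hη0 hη1 hY0.le (div_nonneg hD ht.le) hm1 hmn.le
    calc a₃ = (b * t ^ m) * (Y ^ (m - 1) * (D / t)) := by rw [ha₃, hsplit]; ring
      _ ≤ (b * t ^ m) * (η * Y ^ m + η⁻¹ ^ n * (D / t) ^ m) := by gcongr
      _ = η * ((b * t ^ m) * Y ^ m) + C₃ * (b * (t ^ m * (D / t) ^ m)) := by rw [hC₃]; ring
      _ = _ := by
          rw [← hsplit', ← Real.mul_rpow ht.le (div_nonneg hD ht.le), mul_div_cancel₀ _ ht.ne']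
  rw [hYpow, hYpow]
  have hq1 : 0 ≤ b * D ^ m := by positivity
  have hq2 : 0 ≤ b * t ^ m := hz.le
  have hq3 : 0 ≤ (t ^ m) ^ (n / (n - m + 1)) := by positivity
  have hYn : 0 ≤ Y ^ n := by positivity
  calc _ ≤ C₁ * (a₁ + a₂ + a₃) := hmain
    _ ≤ C₁ * ((η * Y ^ n + C₂ * (b * t ^ m)) +
          (η * Y ^ n + C₃ * (t ^ m) ^ (n / (n - m + 1))) + (η * Y ^ n + C₃ * (b * D ^ m))) := by
        gcongr
    _ ≤ C₁ * ((η * Y ^ n + (C₂ + C₃) * (b * t ^ m)) +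
          (η * Y ^ n + (C₂ + C₃) * (t ^ m) ^ (n / (n - m + 1))) +
            (η * Y ^ n + (C₂ + C₃) * (b * D ^ m))) := by
        gcongr <;> linarith
    _ = C₁ * (3 * η) * Y ^ n +
          C₁ * (C₂ + C₃) * (b * D ^ m + b * t ^ m + (t ^ m) ^ (n / (n - m + 1))) := by ring
    _ ≤ _ := by gcongr

end Pointwise

/-- Lipschitz exponents `m` with values in `[c, d]`, `1 < c`, `d < n`, together with a bounded
nonnegative Lipschitz weight `b`. -/
structure ExponentWeight {G : Type*} [PseudoEMetricSpace G] (n c d B : ℝ) (K L : NNReal)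
    (m b : G → ℝ) : Prop where
  lip_m : LipschitzWith K m
  lip_b : LipschitzWith L b
  one_lt : 1 < c
  c_le : ∀ x, c ≤ m x
  le_d : ∀ x, m x ≤ d
  d_lt : d < n
  b_nonneg : ∀ x, 0 ≤ b x
  b_le : ∀ x, b x ≤ B

/-- The power of `b |u|^m` to which the inequality for total variation is applied. -/
noncomputable def subcriticalPower {G : Type*} (n : ℝ) (m b u : G → ℝ) (x : G) : ℝ :=
  (b x * |u x| ^ m x) ^ ((n - 1) / (n - m x))

lemma ExponentWeight.subcriticalPower_nonneg {G : Type*} [PseudoEMetricSpace G]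
    {n c d B : ℝ} {K L : NNReal} {m b u : G → ℝ} (h : ExponentWeight n c d B K L m b) (x : G) :
    0 ≤ subcriticalPower n m b u x :=
  Real.rpow_nonneg (mul_nonneg (h.b_nonneg x) (Real.rpow_nonneg (abs_nonneg _) _)) _

lemma ExponentWeight.hasCompactSupport_subcriticalPower {G : Type*}
    [PseudoEMetricSpace G] {n c d B : ℝ} {K L : NNReal} {m b u : G → ℝ}
    (h : ExponentWeight n c d B K L m b) (hus : HasCompactSupport u) :
    HasCompactSupport (subcriticalPower n m b u) := by
  refine hus.mono fun x hx => ?_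
  rw [Function.mem_support] at hx ⊢
  refine fun hux => hx ?_
  have h1 : 0 < n - m x := by linarith [h.le_d x, h.d_lt]
  have h2 : 0 < n - 1 := by linarith [h.c_le x, h.one_lt]
  rw [subcriticalPower, hux, abs_zero, Real.zero_rpow (by linarith [h.c_le x, h.one_lt]), mul_zero,
    Real.zero_rpow (by positivity)]

section Functions

variable {G : Type*} [NormedAddCommGroup G] [NormedSpace ℝ G] {n c d B : ℝ} {K L : NNReal}
  {m b u : G → ℝ}

lemma ExponentWeight.norm_fderiv_subcriticalPower_le (h : ExponentWeight n c d B K L m b) {x : G}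
    (hm : DifferentiableAt ℝ m x) (hb : DifferentiableAt ℝ b x) (hu : DifferentiableAt ℝ u x)
    (hb0 : 0 < b x) (hu0 : u x ≠ 0) :
    ‖fderiv ℝ (subcriticalPower n m b u) x‖ ≤
      subcriticalPower n m b u x *
        ((n - 1) / (n - d) ^ 2 * K * |Real.log (b x * |u x| ^ m x)| +
          (n - 1) / (n - m x) *
            (L / b x + K * |Real.log (|u x|)| + m x * (‖fderiv ℝ u x‖ / |u x|))) := by
  have hnm : 0 < n - m x := by linarith [h.le_d x, h.d_lt]
  have hnd : 0 < n - d := by linarith [h.d_lt]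
  have hm0 : 0 < m x := by linarith [h.c_le x, h.one_lt]
  have hn1 : 0 ≤ n - 1 := by linarith [h.c_le x, h.one_lt]
  have he : HasFDerivAt (fun y => (n - 1) / (n - m y))
      (((n - 1) / (n - m x) ^ 2) • fderiv ℝ m x) x := by
    have h1 : HasDerivAt (fun t : ℝ => (n - 1) / (n - t)) ((n - 1) / (n - m x) ^ 2) (m x) := by
      have := (((hasDerivAt_id (m x)).const_sub n).inv hnm.ne').const_mul (n - 1)
      simpa [div_eq_mul_inv] using this
    exact h1.comp_hasFDerivAt x hm.hasFDerivAt
  have hg := he.mul ((hb.hasFDerivAt.log hb0.ne').add (hm.hasFDerivAt.mul (hu.hasFDerivAt.log hu0)))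
  have hlog : Real.log (b x * |u x| ^ m x) = Real.log (b x) + m x * Real.log (u x) := by
    rw [Real.log_mul hb0.ne' (by positivity), Real.log_rpow (abs_pos.2 hu0), Real.log_abs]
  have hval : ∀ y, 0 < b y → u y ≠ 0 → subcriticalPower n m b u y =
      Real.exp ((n - 1) / (n - m y) * (Real.log (b y) + m y * Real.log (u y))) := by
    intro y hby huy
    have hpos : 0 < b y * |u y| ^ m y := mul_pos hby (Real.rpow_pos_of_pos (abs_pos.2 huy) _)
    rw [subcriticalPower, Real.rpow_def_of_pos hpos, Real.log_mul hby.ne'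
      (Real.rpow_pos_of_pos (abs_pos.2 huy) _).ne', Real.log_rpow (abs_pos.2 huy), Real.log_abs,
      mul_comm]
  have heq : subcriticalPower n m b u =ᶠ[nhds x] fun y =>
      Real.exp ((n - 1) / (n - m y) * (Real.log (b y) + m y * Real.log (u y))) := by
    filter_upwards [hb.continuousAt.eventually (lt_mem_nhds hb0),
      hu.continuousAt.eventually_ne hu0] with y hby huy
    exact hval y hby huy
  have hfd := (hg.exp.congr_of_eventuallyEq heq).fderiv
  rw [hfd]
  simp only [Pi.mul_apply, Pi.add_apply]
  rw [← hval x hb0 hu0, norm_smul, Real.norm_of_nonneg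
    (by rw [hval x hb0 hu0]; positivity), ← hlog]
  have hv0 : 0 ≤ subcriticalPower n m b u x := by rw [hval x hb0 hu0]; positivity
  have hK : ‖fderiv ℝ m x‖ ≤ K := norm_fderiv_le_of_lipschitz ℝ h.lip_m
  have hL : ‖fderiv ℝ b x‖ ≤ L := norm_fderiv_le_of_lipschitz ℝ h.lip_b
  have he0 : 0 ≤ (n - 1) / (n - m x) := by positivity
  refine mul_le_mul_of_nonneg_left ?_ hv0
  rw [add_comm]
  refine (norm_add_le _ _).trans (add_le_add ?_ ?_)
  · rw [norm_smul, norm_smul, Real.norm_eq_abs, Real.norm_of_nonneg (by positivity)]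
    calc |Real.log (b x * |u x| ^ m x)| * ((n - 1) / (n - m x) ^ 2 * ‖fderiv ℝ m x‖)
        ≤ |Real.log (b x * |u x| ^ m x)| * ((n - 1) / (n - d) ^ 2 * K) := by
          gcongr
          exact h.le_d x
      _ = _ := by ring
  · rw [norm_smul, Real.norm_of_nonneg he0]
    refine mul_le_mul_of_nonneg_left ?_ he0
    refine (norm_add_le _ _).trans ?_
    rw [add_assoc]
    refine add_le_add ?_ ?_
    · rw [norm_smul, norm_inv, Real.norm_of_nonneg hb0.le, div_eq_inv_mul]
      gcongr
    · rw [add_comm]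
      refine (norm_add_le _ _).trans (add_le_add ?_ ?_)
      · rw [norm_smul, Real.log_abs, mul_comm, Real.norm_eq_abs]
        gcongr
      · rw [norm_smul, norm_smul, norm_inv, Real.norm_of_nonneg hm0.le, Real.norm_eq_abs,
          div_eq_inv_mul]

lemma ExponentWeight.fderiv_subcriticalPower_eq_zero (h : ExponentWeight n c d B K L m b) {x : G}
    (hx : b x * |u x| ^ m x = 0) : fderiv ℝ (subcriticalPower n m b u) x = 0 := by
  refine IsLocalMin.fderiv_eq_zero (Eventually.of_forall fun y => ?_)
  have h0 : subcriticalPower n m b u x = 0 := by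
    rw [subcriticalPower, hx, Real.zero_rpow]
    have : 0 < n - m x := by linarith [h.le_d x, h.d_lt]
    have : 0 < n - 1 := by linarith [h.c_le x, h.one_lt]
    positivity
  rw [h0]
  exact h.subcriticalPower_nonneg y

lemma ExponentWeight.exists_lipschitzWith_subcriticalPower
    (h : ExponentWeight n c d B K L m b) (hu : ContDiff ℝ 1 u) (hus : HasCompactSupport u) :
    ∃ C : NNReal, LipschitzWith C (subcriticalPower n m b u) := by
  have hc := h.one_lt
  have hd := h.d_lt
  have hnm : ∀ x, 0 < n - m x := fun x => by linarith [h.le_d x]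
  obtain ⟨M, hM⟩ := hu.lipschitzWith_of_hasCompactSupport hus one_ne_zero
  obtain ⟨T, hT⟩ := hu.continuous.bounded_above_of_compact_support hus
  have hue : ∀ x, (n - 1) / (n - m x) ≤ (n - 1) / (n - d) := fun x => by
    have := h.le_d x
    have : 0 < n - d := by linarith
    have : 0 ≤ n - 1 := by linarith [h.c_le x]
    gcongr
  have hle : ∀ x, 1 ≤ (n - 1) / (n - m x) := fun x => by
    rw [le_div_iff₀ (hnm x)]; linarith [h.c_le x]
  have he : LipschitzWith (Real.toNNReal ((n - 1) / (n - d) ^ 2) * K)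
      fun x => (n - 1) / (n - m x) := by
    refine LipschitzWith.of_dist_le_mul fun x y => ?_
    have hx := hnm x
    have hy := hnm y
    have hdx := h.le_d x
    have hdy := h.le_d y
    have hn1 : 0 ≤ n - 1 := by linarith [h.c_le x]
    have hnd : 0 < n - d := by linarith
    have h1 := h.lip_m.dist_le_mul x y
    rw [Real.dist_eq] at h1
    rw [NNReal.coe_mul, Real.coe_toNNReal _ (by positivity), Real.dist_eq]
    have h2 : (n - 1) / (n - m x) - (n - 1) / (n - m y) =
        (n - 1) / ((n - m x) * (n - m y)) * (m x - m y) := by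
      field_simp; ring
    rw [h2, abs_mul, abs_of_nonneg (by positivity), mul_assoc, sq]
    gcongr
  have hme : ∃ Q : NNReal, LipschitzWith Q fun x => m x * ((n - 1) / (n - m x)) := by
    refine exists_lipschitzWith_mul (A := d) (B := (n - 1) / (n - d)) h.lip_m he
      (fun x => ?_) fun x => ?_
    · rw [abs_of_nonneg (by linarith [h.c_le x])]; exact h.le_d x
    · rw [abs_of_nonneg (by linarith [hle x])]; exact hue x
  obtain ⟨Q, hQ⟩ := hme
  have hme1 : ∀ x, 1 ≤ m x * ((n - 1) / (n - m x)) := fun x => by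
    nlinarith [hle x, h.c_le x]
  have habs : LipschitzWith M fun x => |u x| := by
    refine LipschitzWith.of_dist_le_mul fun x y => ?_
    rw [Real.dist_eq]
    refine (abs_abs_sub_abs_le_abs_sub _ _).trans ?_
    rw [← Real.dist_eq]
    exact hM.dist_le_mul x y
  obtain ⟨C₁, hC₁⟩ := exists_lipschitzWith_rpow (B := B) h.lip_b he h.b_nonneg h.b_le hle hue
  obtain ⟨C₂, hC₂⟩ := exists_lipschitzWith_rpow (B := T) (M := d * ((n - 1) / (n - d))) habs hQ
    (fun x => abs_nonneg _) hT hme1 fun x => by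
      have := hle x
      have := h.c_le x
      exact mul_le_mul (h.le_d x) (hue x) (by linarith) (by linarith [h.le_d x])
  obtain ⟨C₃, hC₃⟩ := exists_lipschitzWith_mul (A := (max B 1) ^ ((n - 1) / (n - d)))
    (B := (max T 1) ^ (d * ((n - 1) / (n - d)))) hC₁ hC₂ (fun x => by
      have hb0 := h.b_nonneg x
      rw [abs_of_nonneg (by positivity)]
      have := hle x
      calc b x ^ ((n - 1) / (n - m x)) ≤ (max B 1) ^ ((n - 1) / (n - m x)) := by
            gcongr
            exact (h.b_le x).trans (le_max_left _ _)
        _ ≤ _ := Real.rpow_le_rpow_of_exponent_le (le_max_right _ _) (hue x)) (fun x => by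
      rw [abs_of_nonneg (by positivity)]
      have := hme1 x
      have := hle x
      have := h.c_le x
      calc |u x| ^ (m x * ((n - 1) / (n - m x))) ≤
            (max T 1) ^ (m x * ((n - 1) / (n - m x))) := by
            gcongr
            exact (hT x).trans (le_max_left _ _)
        _ ≤ _ := Real.rpow_le_rpow_of_exponent_le (le_max_right _ _)
            (mul_le_mul (h.le_d x) (hue x) (by linarith) (by linarith [h.le_d x])))
  refine ⟨C₃, ?_⟩
  have heq : subcriticalPower n m b u =
      fun x => b x ^ ((n - 1) / (n - m x)) * |u x| ^ (m x * ((n - 1) / (n - m x))) := by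
    funext x
    rw [subcriticalPower, Real.mul_rpow (h.b_nonneg x) (by positivity),
      ← Real.rpow_mul (abs_nonneg _)]
  rwa [heq]

end Functions

section Modular

variable {G : Type*} [MeasurableSpace G]

/-- The modular `∫ w |f|^k dμ` of a weighted variable power. -/
noncomputable def powMod (μ : Measure G) (w k f : G → ℝ) : ℝ≥0∞ :=
  ∫⁻ x, ENNReal.ofReal (w x * |f x| ^ k x) ∂μ

lemma powMod_inv_smul_le (μ : Measure G) {w k : G → ℝ} (hw : ∀ x, 0 ≤ w x) (hk : ∀ x, 1 ≤ k x)
    {l : ℝ} (hl : 1 ≤ l) (f : G → ℝ) :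
    powMod μ w k (l⁻¹ • f) ≤ ENNReal.ofReal l⁻¹ * powMod μ w k f := by
  have hl0 : 0 < l := by linarith
  rw [powMod, powMod, ← lintegral_const_mul' _ _ ENNReal.ofReal_ne_top]
  refine lintegral_mono fun x => ?_
  rw [← ENNReal.ofReal_mul (by positivity)]
  refine ENNReal.ofReal_le_ofReal ?_
  rw [Pi.smul_apply, smul_eq_mul, abs_mul, abs_of_pos (inv_pos.2 hl0),
    Real.mul_rpow (by positivity) (abs_nonneg _)]
  have h1 : l⁻¹ ^ k x ≤ l⁻¹ := by
    calc l⁻¹ ^ k x ≤ l⁻¹ ^ (1 : ℝ) :=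
          Real.rpow_le_rpow_of_exponent_ge (by positivity) (inv_le_one_of_one_le₀ hl) (hk x)
      _ = l⁻¹ := Real.rpow_one _
  calc w x * (l⁻¹ ^ k x * |f x| ^ k x) ≤ w x * (l⁻¹ * |f x| ^ k x) := by
        gcongr
        exact hw x
    _ = _ := by ring

lemma powMod_le_two_rpow_mul (μ : Measure G) {w k : G → ℝ} (hw : ∀ x, 0 ≤ w x) {M : ℝ}
    (hk : ∀ x, k x ≤ M) (f : G → ℝ) :
    powMod μ w k f ≤ ENNReal.ofReal (2 ^ M) * powMod μ w k ((2 : ℝ)⁻¹ • f) := by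
  rw [powMod, powMod, ← lintegral_const_mul' _ _ ENNReal.ofReal_ne_top]
  refine lintegral_mono fun x => ?_
  rw [← ENNReal.ofReal_mul (by positivity)]
  refine ENNReal.ofReal_le_ofReal ?_
  have h0 := hw x
  calc w x * |f x| ^ k x = 2 ^ k x * (w x * |(2 : ℝ)⁻¹ * f x| ^ k x) := by
        rw [abs_mul, Real.mul_rpow (abs_nonneg _) (abs_nonneg _), abs_of_pos (by norm_num : (0 : ℝ) < 2⁻¹),
          Real.inv_rpow (by norm_num)]
        have : (2 : ℝ) ^ k x ≠ 0 := by positivity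
        field_simp
    _ ≤ 2 ^ M * (w x * |(2 : ℝ)⁻¹ * f x| ^ k x) := by
        gcongr
        · norm_num
        · exact hk x

end Modular

section GradMod

variable {G : Type*} [NormedAddCommGroup G] [NormedSpace ℝ G] [MeasurableSpace G]

/-- The modular `∫ w |∇u|^k dμ`. -/
noncomputable def gradMod (μ : Measure G) (w k u : G → ℝ) : ℝ≥0∞ :=
  powMod μ w k fun x => ‖fderiv ℝ u x‖

lemma gradMod_inv_smul_le (μ : Measure G) {w k : G → ℝ} (hw : ∀ x, 0 ≤ w x) (hk : ∀ x, 1 ≤ k x)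
    {l : ℝ} (hl : 1 ≤ l) (u : G → ℝ) :
    gradMod μ w k (l⁻¹ • u) ≤ ENNReal.ofReal l⁻¹ * gradMod μ w k u := by
  refine le_trans (le_of_eq ?_) (powMod_inv_smul_le μ hw hk hl _)
  rw [gradMod]
  congr 1
  funext x
  rw [fderiv_const_smul_field, Pi.smul_apply, norm_smul, Pi.smul_apply, smul_eq_mul,
    Real.norm_of_nonneg (inv_nonneg.2 (by linarith))]

end GradMod

section CriticalInequality

variable {G : Type*} [NormedAddCommGroup G] [NormedSpace ℝ G] [FiniteDimensional ℝ G]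
  [MeasurableSpace G] [BorelSpace G] {n c d B : ℝ} {K L : NNReal} {m b : G → ℝ}

lemma ExponentWeight.ae_norm_fderiv_subcriticalPower_le (μ : Measure G) [μ.IsAddHaarMeasure]
    (h : ExponentWeight n c d B K L m b) {δ : ℝ} (hδ : 0 < δ) :
    ∃ C : ℝ, 0 ≤ C ∧ ∀ u : G → ℝ, ContDiff ℝ 1 u → ∀ᵐ x ∂μ,
      ‖fderiv ℝ (subcriticalPower n m b u) x‖ ≤
        δ * (b x ^ (n / (n - m x)) * |u x| ^ (n * m x / (n - m x))) +
        C * (b x * |‖fderiv ℝ u x‖| ^ m x + b x * |u x| ^ m x +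
          |u x| ^ (n * m x / (n - m x + 1))) := by
  have hnc : ∀ x, 0 ≤ n - 1 := fun x => by linarith [h.one_lt, h.c_le x, h.le_d x, h.d_lt]
  obtain ⟨C, hC0, hC⟩ := exists_weighted_absorption (n := n) (c := c) (d := d) (B := B)
    (E := (n - 1) / (n - d) ^ 2 * K) (K := K) (L := L) h.one_lt h.d_lt
    (mul_nonneg (div_nonneg (hnc 0) (sq_nonneg _)) K.2) K.2 L.2 hδ
  refine ⟨C, hC0, fun u hu => ?_⟩
  filter_upwards [h.lip_m.ae_differentiableAt (μ := μ), h.lip_b.ae_differentiableAt (μ := μ)]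
    with x hmx hbx
  have hb0 := h.b_nonneg x
  have hnm : 0 < n - m x := by linarith [h.le_d x, h.d_lt]
  rw [abs_norm]
  by_cases hz : b x * |u x| ^ m x = 0
  · rw [h.fderiv_subcriticalPower_eq_zero hz, norm_zero]
    positivity
  have hbpos : 0 < b x := hb0.lt_of_ne fun h0 => hz (by rw [← h0, zero_mul])
  have hu0 : u x ≠ 0 := fun h0 => hz (by
    rw [h0, abs_zero, Real.zero_rpow (by linarith [h.c_le x, h.one_lt]), mul_zero])
  have h1 := h.norm_fderiv_subcriticalPower_le hmx hbx
    (hu.differentiable one_ne_zero x) hbpos hu0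
  refine h1.trans ((hC (m x) (b x) |u x| ‖fderiv ℝ u x‖ (h.c_le x) (h.le_d x) hbpos (h.b_le x)
    (abs_pos.2 hu0) (norm_nonneg _)).trans_eq ?_)
  rw [Real.mul_rpow hb0 (by positivity), ← Real.rpow_mul (abs_nonneg _),
    ← Real.rpow_mul (abs_nonneg _), mul_div_assoc', mul_div_assoc', mul_comm (m x) n]

lemma ExponentWeight.exists_powMod_le (μ : Measure G) [μ.IsAddHaarMeasure]
    (h : ExponentWeight n c d B K L m b) (hn : n = Module.finrank ℝ G) {δ : ℝ} (hδ : 0 < δ) :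
    ∃ C : ℝ, 0 ≤ C ∧ ∀ u : G → ℝ, ContDiff ℝ 1 u → HasCompactSupport u →
      powMod μ (fun x => b x ^ (n / (n - m x))) (fun x => n * m x / (n - m x)) u ≤
        lintegralPowLePowLIntegralFDerivConst μ n.conjExponent *
        (ENNReal.ofReal δ *
            powMod μ (fun x => b x ^ (n / (n - m x))) (fun x => n * m x / (n - m x)) u +
          ENNReal.ofReal C * (gradMod μ b m u + powMod μ b m u +
            powMod μ (fun _ => 1) (fun x => n * m x / (n - m x + 1)) u)) ^ n.conjExponent := by
  obtain ⟨C, hC0, hC⟩ := h.ae_norm_fderiv_subcriticalPower_le μ hδ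
  refine ⟨C, hC0, fun u hu hus => ?_⟩
  have hn1 : 1 < n := by linarith [h.one_lt, h.c_le 0, h.le_d 0, h.d_lt]
  have hP : (Module.finrank ℝ G : ℝ).HolderConjugate n.conjExponent := by
    rw [← hn]; exact Real.HolderConjugate.conjExponent hn1
  obtain ⟨Q, hQ⟩ := h.exists_lipschitzWith_subcriticalPower hu hus
  have hGNS := lintegral_rpow_le_of_lipschitzWith μ hQ
    (h.hasCompactSupport_subcriticalPower hus) hP
  have hleft : ∫⁻ x, ‖subcriticalPower n m b u x‖ₑ ^ n.conjExponent ∂μ =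
      powMod μ (fun x => b x ^ (n / (n - m x))) (fun x => n * m x / (n - m x)) u := by
    refine lintegral_congr fun x => ?_
    have hnm : 0 < n - m x := by linarith [h.le_d x, h.d_lt]
    have hn0 : n - 1 ≠ 0 := by linarith
    have hz : 0 ≤ b x * |u x| ^ m x := mul_nonneg (h.b_nonneg x) (by positivity)
    rw [Real.enorm_of_nonneg (h.subcriticalPower_nonneg x),
      ENNReal.ofReal_rpow_of_nonneg (h.subcriticalPower_nonneg x) hP.symm.nonneg,
      subcriticalPower, ← Real.rpow_mul hz]
    have he : (n - 1) / (n - m x) * n.conjExponent = n / (n - m x) := by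
      rw [Real.conjExponent]; field_simp
    rw [he, Real.mul_rpow (h.b_nonneg x) (by positivity), ← Real.rpow_mul (abs_nonneg _),
      mul_div_assoc', mul_comm (m x) n]
  rw [hleft] at hGNS
  refine hGNS.trans (mul_le_mul_right (ENNReal.rpow_le_rpow ?_ hP.symm.nonneg) _)
  have hmm : Measurable m := h.lip_m.continuous.measurable
  have hbm : Measurable b := h.lip_b.continuous.measurable
  have hum : Measurable u := hu.continuous.measurable
  have hua : Measurable fun x => |u x| := hu.continuous.abs.measurable
  have hDm : Measurable fun x => |‖fderiv ℝ u x‖| := (measurable_fderiv ℝ u).norm.abs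
  have hnm : Measurable fun x => n - m x := hmm.const_sub n
  calc ∫⁻ x, ‖fderiv ℝ (subcriticalPower n m b u) x‖ₑ ∂μ
      ≤ ∫⁻ x, (ENNReal.ofReal δ *
          ENNReal.ofReal (b x ^ (n / (n - m x)) * |u x| ^ (n * m x / (n - m x))) +
        ENNReal.ofReal C * (ENNReal.ofReal (b x * |‖fderiv ℝ u x‖| ^ m x) +
          ENNReal.ofReal (b x * |u x| ^ m x) +
          ENNReal.ofReal (1 * |u x| ^ (n * m x / (n - m x + 1))))) ∂μ := by
        refine lintegral_mono_ae ((hC u hu).mono fun x hx => ?_)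
        have hb0 := h.b_nonneg x
        rw [← ofReal_norm, ← ENNReal.ofReal_add (by positivity) (by positivity),
          ← ENNReal.ofReal_add (by positivity) (by positivity), ← ENNReal.ofReal_mul hδ.le,
          ← ENNReal.ofReal_mul hC0, ← ENNReal.ofReal_add (by positivity) (by positivity), one_mul]
        exact ENNReal.ofReal_le_ofReal hx
    _ = _ := by
        have m1 : Measurable fun x =>
            ENNReal.ofReal (b x ^ (n / (n - m x)) * |u x| ^ (n * m x / (n - m x))) :=
          ((hbm.pow (hnm.const_div n)).mul
            (hua.pow ((hmm.const_mul n).div hnm))).ennreal_ofReal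
        have m2 : Measurable fun x => ENNReal.ofReal (b x * |‖fderiv ℝ u x‖| ^ m x) :=
          (hbm.mul (hDm.pow hmm)).ennreal_ofReal
        have m3 : Measurable fun x => ENNReal.ofReal (b x * |u x| ^ m x) :=
          (hbm.mul (hua.pow hmm)).ennreal_ofReal
        have m23 : Measurable fun x => ENNReal.ofReal (b x * |‖fderiv ℝ u x‖| ^ m x) +
            ENNReal.ofReal (b x * |u x| ^ m x) := m2.add m3
        rw [lintegral_add_left (m1.const_mul _), lintegral_const_mul' _ _ ENNReal.ofReal_ne_top,
          lintegral_const_mul' _ _ ENNReal.ofReal_ne_top, lintegral_add_left m23,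
          lintegral_add_left m2]
        rfl

end CriticalInequality

section Shrinking

variable {G : Type*}

/-- Functionals that decrease at least linearly when the argument is shrunk. -/
def IsShrinking (X : (G → ℝ) → ℝ≥0∞) : Prop :=
  ∀ l : ℝ, 1 ≤ l → ∀ u : G → ℝ, X (l⁻¹ • u) ≤ ENNReal.ofReal l⁻¹ * X u

lemma IsShrinking.add {X Y : (G → ℝ) → ℝ≥0∞} (hX : IsShrinking X) (hY : IsShrinking Y) :
    IsShrinking fun u => X u + Y u := fun l hl u => by
  rw [mul_add]; exact add_le_add (hX l hl u) (hY l hl u)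

lemma IsShrinking.le {X : (G → ℝ) → ℝ≥0∞} (hX : IsShrinking X) {l : ℝ} (hl : 1 ≤ l)
    (u : G → ℝ) : X (l⁻¹ • u) ≤ X u := by
  refine (hX l hl u).trans (mul_le_of_le_one_left' ?_)
  rw [ENNReal.ofReal_le_one]
  exact inv_le_one_of_one_le₀ hl

lemma IsShrinking.exists_le {X : (G → ℝ) → ℝ≥0∞} (hX : IsShrinking X) {A κ : ℝ}
    (hκ : 0 < κ) : ∃ l : ℝ, 1 ≤ l ∧ ∀ u, X u ≤ ENNReal.ofReal A →
      X (l⁻¹ • u) ≤ ENNReal.ofReal κ := by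
  refine ⟨max 1 (A / κ), le_max_left _ _, fun u hu => ?_⟩
  set l := max 1 (A / κ)
  have hl : 0 < l := lt_of_lt_of_le one_pos (le_max_left _ _)
  calc X (l⁻¹ • u) ≤ ENNReal.ofReal l⁻¹ * ENNReal.ofReal A :=
        (hX l (le_max_left _ _) u).trans (by gcongr)
    _ = ENNReal.ofReal (l⁻¹ * A) := (ENNReal.ofReal_mul (by positivity)).symm
    _ ≤ ENNReal.ofReal κ := by
        refine ENNReal.ofReal_le_ofReal ?_
        rw [inv_mul_le_iff₀ hl, ← div_le_iff₀ hκ]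
        exact le_max_right _ _

end Shrinking

section Bootstrap

variable {G : Type*} [NormedAddCommGroup G] [NormedSpace ℝ G]

/-- Smooth compactly supported functions. -/
def IsTest (u : G → ℝ) : Prop := ContDiff ℝ (⊤ : ℕ∞) u ∧ HasCompactSupport u

lemma IsTest.smul {u : G → ℝ} (hu : IsTest u) (l : ℝ) : IsTest (l • u) :=
  ⟨contDiff_const.smul hu.1, hu.2.smul_left (f := fun _ => l)⟩

lemma IsTest.contDiff_one {u : G → ℝ} (hu : IsTest u) : ContDiff ℝ 1 u :=
  hu.1.of_le (by exact_mod_cast le_top)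

/-- A superlinear absorption inequality forces the critical functional `X` to be at most one as soon
as the lower order functional `A` is small. -/
lemma exists_small_imp_le_one {X A : (G → ℝ) → ℝ≥0∞} {M : ℝ} {Q : NNReal} {P : ℝ} (hP : 0 < P)
    (hM : 0 ≤ M) (hX : IsShrinking X) (hA : IsShrinking A)
    (hfin : ∀ u, IsTest u → X u ≠ ⊤)
    (hdouble : ∀ u, X u ≤ ENNReal.ofReal M * X ((2 : ℝ)⁻¹ • u))
    (habs : ∀ δ : ℝ, 0 < δ → ∃ C : ℝ, 0 ≤ C ∧ ∀ u, IsTest u →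
      X u ≤ Q * (ENNReal.ofReal δ * X u + ENNReal.ofReal C * A u) ^ P) :
    ∃ κ : ℝ, 0 < κ ∧ ∀ u, IsTest u → A u ≤ ENNReal.ofReal κ → X u ≤ 1 := by
  set η : ℝ := (M * Q + 1)⁻¹ ^ P⁻¹ with hη
  have hη0 : 0 < η := by positivity
  have hηP : M * Q * η ^ P < 1 := by
    rw [hη, ← Real.rpow_mul (by positivity), inv_mul_cancel₀ hP.ne', Real.rpow_one,
      ← div_eq_mul_inv, div_lt_one (by positivity)]
    linarith
  obtain ⟨C, hC0, hC⟩ := habs (η / 2) (by positivity)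
  refine ⟨η / 2 / (C + 1), by positivity, fun u hu hAu => ?_⟩
  by_contra! hlt
  have hone : (1 : ℝ) ≤ 2 := one_le_two
  have step : ∀ w, IsTest w → A w ≤ ENNReal.ofReal (η / 2 / (C + 1)) → 1 < X w →
      1 < X ((2 : ℝ)⁻¹ • w) := by
    intro w hw hAw hXw
    by_contra! hle
    set v := (2 : ℝ)⁻¹ • w
    have hAv : ENNReal.ofReal C * A v ≤ ENNReal.ofReal (η / 2) := by
      calc ENNReal.ofReal C * A v ≤ ENNReal.ofReal C * ENNReal.ofReal (η / 2 / (C + 1)) := by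
            gcongr
            exact (hA.le hone w).trans hAw
        _ = ENNReal.ofReal (C * (η / 2 / (C + 1))) := (ENNReal.ofReal_mul hC0).symm
        _ ≤ ENNReal.ofReal (η / 2) := by
            refine ENNReal.ofReal_le_ofReal ?_
            rw [mul_div_assoc', div_le_iff₀ (by positivity)]
            nlinarith
    have h1 : X v ≤ Q * (ENNReal.ofReal η) ^ P := by
      refine (hC v (hw.smul _)).trans ?_
      gcongr
      calc ENNReal.ofReal (η / 2) * X v + ENNReal.ofReal C * A v
          ≤ ENNReal.ofReal (η / 2) * 1 + ENNReal.ofReal (η / 2) := by gcongr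
        _ = ENNReal.ofReal η := by
            rw [mul_one, ← ENNReal.ofReal_add (by positivity) (by positivity), add_halves]
    have h2 : X w < 1 := by
      calc X w ≤ ENNReal.ofReal M * (Q * (ENNReal.ofReal η) ^ P) :=
            (hdouble w).trans (by gcongr)
        _ = ENNReal.ofReal (M * Q * η ^ P) := by
            rw [ENNReal.ofReal_mul (by positivity), ENNReal.ofReal_mul hM,
              ENNReal.ofReal_coe_nnreal, ENNReal.ofReal_rpow_of_nonneg hη0.le hP.le, mul_assoc]
        _ < 1 := by rwa [ENNReal.ofReal_lt_one]
    exact absurd hXw h2.not_gt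
  have hpow : ∀ k : ℕ, 1 < X (((2 : ℝ) ^ k)⁻¹ • u) := by
    intro k
    induction k with
    | zero => simpa using hlt
    | succ k ih =>
      have := step _ (hu.smul _) ((hA.le (one_le_pow₀ hone) u).trans hAu) ih
      rwa [smul_smul, ← mul_inv, ← pow_succ'] at this
  obtain ⟨k, hk⟩ := pow_unbounded_of_one_lt (X u).toReal (one_lt_two (α := ℝ))
  have hk2 := hX (2 ^ k) (one_le_pow₀ hone) u
  refine absurd (hpow k) (not_lt.2 (hk2.trans ?_))
  rw [← ENNReal.ofReal_toReal (hfin u hu), ← ENNReal.ofReal_mul (by positivity),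
    ENNReal.ofReal_le_one, inv_mul_le_iff₀ (by positivity), mul_one]
  exact hk.le

end Bootstrap

section Interpolation

variable {G : Type*} [MeasurableSpace G]

lemma powMod_le_add (μ : Measure G) {w j k l f : G → ℝ} (hw : ∀ x, 0 ≤ w x) (hjk : ∀ x, j x ≤ k x)
    (hkl : ∀ x, k x ≤ l x) (hj : ∀ x, 0 < j x) (hwm : Measurable w) (hjm : Measurable j)
    (hf : Measurable f) : powMod μ w k f ≤ powMod μ w j f + powMod μ w l f := by
  have hm : Measurable fun x => ENNReal.ofReal (w x * |f x| ^ j x) :=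
    (hwm.mul (hf.abs.pow hjm)).ennreal_ofReal
  rw [powMod, powMod, powMod, ← lintegral_add_left hm]
  refine lintegral_mono fun x => ?_
  have hwx := hw x
  rw [← ENNReal.ofReal_add (by positivity) (by positivity), ← mul_add]
  refine ENNReal.ofReal_le_ofReal (mul_le_mul_of_nonneg_left ?_ hwx)
  have h1 : 0 ≤ |f x| ^ j x := by positivity
  have h2 : 0 ≤ |f x| ^ l x := by positivity
  rcases le_total |f x| 1 with h | h
  · rcases (abs_nonneg (f x)).eq_or_lt with h0 | h0
    · rw [← h0, Real.zero_rpow ((hj x).trans_le (hjk x)).ne'] at *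
      positivity
    · linarith [Real.rpow_le_rpow_of_exponent_ge h0 h (hjk x)]
  · linarith [Real.rpow_le_rpow_of_exponent_le h (hkl x)]

lemma powMod_rpow_mul (μ : Measure G) {b q f : G → ℝ} (hb : ∀ x, 0 ≤ b x) (k : G → ℝ) :
    powMod μ (fun _ => 1) k (fun x => b x ^ (1 / q x) * f x) =
      powMod μ (fun x => b x ^ (k x / q x)) k f := by
  refine lintegral_congr fun x => ?_
  have := hb x
  rw [one_mul, abs_mul, abs_of_nonneg (by positivity : 0 ≤ b x ^ (1 / q x)),
    Real.mul_rpow (by positivity) (abs_nonneg _), ← Real.rpow_mul this, one_div_mul_eq_div]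

lemma powMod_intermediate_le (μ : Measure G) {n δ : ℝ} {m f : G → ℝ} (hδ : 0 < δ) (hδ1 : δ ≤ 1)
    (hm : ∀ x, 1 < m x) (hmn : ∀ x, m x < n) (hmm : Measurable m) (hf : Measurable f) :
    powMod μ (fun _ => 1) (fun x => n * m x / (n - m x + 1)) f ≤
      ENNReal.ofReal δ * powMod μ (fun _ => 1) (fun x => n * m x / (n - m x)) f +
        ENNReal.ofReal (δ⁻¹ ^ n) * powMod μ (fun _ => 1) m f := by
  have hme : Measurable fun x => ENNReal.ofReal (1 * |f x| ^ m x) :=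
    ((hf.abs.pow hmm).const_mul 1).ennreal_ofReal
  rw [powMod, powMod, powMod, ← lintegral_const_mul' _ _ ENNReal.ofReal_ne_top,
    ← lintegral_const_mul' _ _ ENNReal.ofReal_ne_top, ← lintegral_add_right _ (hme.const_mul _)]
  refine lintegral_mono fun x => ?_
  rw [one_mul, one_mul, one_mul, ← ENNReal.ofReal_mul hδ.le, ← ENNReal.ofReal_mul (by positivity),
    ← ENNReal.ofReal_add (by positivity) (by positivity)]
  refine ENNReal.ofReal_le_ofReal ?_
  have hnm : 0 < n - m x := sub_pos.2 (hmn x)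
  have h := rpow_intermediate_le hδ hδ1
    (Real.rpow_nonneg (abs_nonneg (f x)) (m x / (n - m x))) (hm x) (hmn x)
  simp only [← Real.rpow_mul (abs_nonneg (f x))] at h
  convert h using 2
  · field_simp
  · congr 2; field_simp
  · congr 1; field_simp

end Interpolation

lemma powMod_ne_top {G : Type*} [TopologicalSpace G] [MeasurableSpace G]
    [OpensMeasurableSpace G] (μ : Measure G) [IsFiniteMeasureOnCompacts μ] {w k f : G → ℝ}
    (hw : Continuous w) (hk : Continuous k) (hk0 : ∀ x, 0 < k x) (hf : Continuous f)
    (hfs : HasCompactSupport f) : powMod μ w k f ≠ ⊤ := by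
  have hc : Continuous fun x => w x * |f x| ^ k x :=
    hw.mul (hf.abs.rpow hk fun x => Or.inr (hk0 x))
  refine (hc.integrable_of_hasCompactSupport (μ := μ) (hfs.mono fun x hx => ?_)).lintegral_lt_top.ne
  refine fun h0 => hx ?_
  simp only [h0, abs_zero, Real.zero_rpow (hk0 x).ne', mul_zero]

lemma gradMod_ne_top {G : Type*} [NormedAddCommGroup G] [NormedSpace ℝ G] [MeasurableSpace G]
    [OpensMeasurableSpace G] (μ : Measure G) [IsFiniteMeasureOnCompacts μ] {w k u : G → ℝ}
    (hw : Continuous w) (hk : Continuous k) (hk0 : ∀ x, 0 < k x) (hu : IsTest u) :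
    gradMod μ w k u ≠ ⊤ :=
  powMod_ne_top μ hw hk hk0 (hu.contDiff_one.continuous_fderiv one_ne_zero).norm
    (hu.2.fderiv ℝ).norm

section Exponents

variable {G : Type*} [PseudoEMetricSpace G] {n c d B : ℝ} {K L : NNReal} {m b : G → ℝ}

lemma ExponentWeight.one_le (h : ExponentWeight n c d B K L m b) (x : G) : 1 ≤ m x :=
  h.one_lt.le.trans (h.c_le x)

lemma ExponentWeight.one_le_critical (h : ExponentWeight n c d B K L m b) (x : G) :
    1 ≤ n * m x / (n - m x) := by
  have h1 := h.one_le x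
  have h2 := h.le_d x
  have h3 := h.d_lt
  rw [one_le_div (by linarith)]
  nlinarith

lemma ExponentWeight.critical_le (h : ExponentWeight n c d B K L m b) (x : G) :
    n * m x / (n - m x) ≤ n * n / (n - d) := by
  have h1 := h.one_le x
  have h2 := h.le_d x
  have h3 := h.d_lt
  have : 0 < n - d := by linarith
  have : 0 < n := by linarith
  gcongr
  linarith

lemma ExponentWeight.one_le_intermediate (h : ExponentWeight n c d B K L m b) (x : G) :
    1 ≤ n * m x / (n - m x + 1) := by
  have h1 := h.one_le x
  have h2 := h.le_d x
  have h3 := h.d_lt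
  rw [one_le_div (by linarith)]
  nlinarith

end Exponents

section SmallModular

variable {G : Type*} [NormedAddCommGroup G] [NormedSpace ℝ G] [FiniteDimensional ℝ G]
  [MeasurableSpace G] [BorelSpace G] {n c d B : ℝ} {K L : NNReal} {m b : G → ℝ}

/-- The critical modular is at most one once the lower order modulars are small. -/
lemma ExponentWeight.exists_small_imp_powMod_le_one (μ : Measure G) [μ.IsAddHaarMeasure]
    (h : ExponentWeight n c d B K L m b) (hn : n = Module.finrank ℝ G)
    {A : (G → ℝ) → ℝ≥0∞} (hA : IsShrinking A)
    (hA1 : ∀ u, gradMod μ b m u + powMod μ b m u ≤ A u)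
    (hA2 : ∀ δ : ℝ, 0 < δ → ∃ C : ℝ, 0 ≤ C ∧ ∀ u, IsTest u →
      powMod μ (fun _ => 1) (fun x => n * m x / (n - m x + 1)) u ≤
        ENNReal.ofReal δ *
          powMod μ (fun x => b x ^ (n / (n - m x))) (fun x => n * m x / (n - m x)) u +
        ENNReal.ofReal C * A u) :
    ∃ κ : ℝ, 0 < κ ∧ ∀ u, IsTest u → A u ≤ ENNReal.ofReal κ →
      powMod μ (fun x => b x ^ (n / (n - m x))) (fun x => n * m x / (n - m x)) u ≤ 1 := by
  have hnm : ∀ x, 0 < n - m x := fun x => by linarith [h.le_d x, h.d_lt]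
  have hn1 : 1 < n := by linarith [h.one_lt, h.c_le 0, h.le_d 0, h.d_lt]
  have hwn : ∀ x, 0 ≤ b x ^ (n / (n - m x)) := fun x => Real.rpow_nonneg (h.b_nonneg x) _
  have hmc := h.lip_m.continuous
  have hdc : Continuous fun x => n - m x := continuous_const.sub hmc
  refine exists_small_imp_le_one (M := 2 ^ (n * n / (n - d)))
    (Q := lintegralPowLePowLIntegralFDerivConst μ n.conjExponent) (P := n.conjExponent)
    (Real.HolderConjugate.conjExponent hn1).symm.pos (by positivity)
    (fun l hl u => powMod_inv_smul_le μ hwn h.one_le_critical hl u) hA (fun u hu => ?_)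
    (fun u => powMod_le_two_rpow_mul μ hwn h.critical_le u) fun δ hδ => ?_
  · refine powMod_ne_top μ (h.lip_b.continuous.rpow (continuous_const.div hdc fun x => (hnm x).ne')
      fun x => Or.inr (div_pos (by linarith) (hnm x)))
      ((continuous_const.mul hmc).div hdc fun x => (hnm x).ne')
      (fun x => one_pos.trans_le (h.one_le_critical x)) hu.1.continuous hu.2
  obtain ⟨C, hC0, hC⟩ := h.exists_powMod_le μ hn (half_pos hδ)
  obtain ⟨D, hD0, hD⟩ := hA2 (δ / 2 / (C + 1)) (by positivity)
  refine ⟨C * (1 + D), by positivity, fun u hu => (hC u hu.contDiff_one hu.2).trans ?_⟩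
  set X := powMod μ (fun x => b x ^ (n / (n - m x))) (fun x => n * m x / (n - m x)) u
  refine mul_le_mul_right (ENNReal.rpow_le_rpow ?_
    (Real.HolderConjugate.conjExponent hn1).symm.nonneg) _
  have hCδ : C * (δ / 2 / (C + 1)) ≤ δ / 2 := by
    rw [mul_div_assoc', div_le_iff₀ (by positivity)]
    nlinarith
  calc ENNReal.ofReal (δ / 2) * X + ENNReal.ofReal C * (gradMod μ b m u + powMod μ b m u +
        powMod μ (fun _ => 1) (fun x => n * m x / (n - m x + 1)) u)
      ≤ ENNReal.ofReal (δ / 2) * X + ENNReal.ofReal C * (A u +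
        (ENNReal.ofReal (δ / 2 / (C + 1)) * X + ENNReal.ofReal D * A u)) := by
        gcongr
        · exact hA1 u
        · exact hD u hu
    _ = (ENNReal.ofReal (δ / 2) + ENNReal.ofReal (C * (δ / 2 / (C + 1)))) * X +
        ENNReal.ofReal (C * (1 + D)) * A u := by
        rw [ENNReal.ofReal_mul hC0, ENNReal.ofReal_mul hC0,
          ENNReal.ofReal_add zero_le_one hD0, ENNReal.ofReal_one]
        ring
    _ ≤ ENNReal.ofReal δ * X + ENNReal.ofReal (C * (1 + D)) * A u := by
        rw [← ENNReal.ofReal_add (by positivity) (by positivity)]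
        gcongr
        linarith

end SmallModular

section DoublePhase

variable {N : ℕ} {p q a r s : EuclideanSpace ℝ (Fin N) → ℝ}

lemma CondD.exists_exponentWeight (hD : CondD N p q a) :
    ∃ (c d B : ℝ) (K K' L : NNReal), ExponentWeight N c d B K 0 p (fun _ => 1) ∧
      ExponentWeight N c d B K' L q a := by
  obtain ⟨K, hK⟩ := hD.lip_p
  obtain ⟨K', hK'⟩ := hD.lip_q
  obtain ⟨L, hL⟩ := hD.lip_a
  obtain ⟨c, hc1, hc⟩ := hD.inf_p
  obtain ⟨d, hdN, hd⟩ := hD.sup_q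
  obtain ⟨B, hB⟩ := hD.a_bdd
  exact ⟨c, d, max 1 B, K, K', L,
    ⟨hK, LipschitzWith.const 1, hc1, hc, fun x => (hD.p_lt_q x).le.trans (hd x), hdN,
      fun _ => zero_le_one, fun _ => le_max_left _ _⟩,
    ⟨hK', hL, hc1, fun x => (hc x).trans (hD.p_lt_q x).le, hd, hdN, hD.a_nonneg,
      fun x => (hB x).trans (le_max_right _ _)⟩⟩

/-- The Sobolev modular `∫ H(x,|∇u|) + H(x,|u|) dx`, split into its four terms. -/
noncomputable def sobMod {N : ℕ} (p q a u : EuclideanSpace ℝ (Fin N) → ℝ) : ℝ≥0∞ :=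
  gradMod volume (fun _ => 1) p u + powMod volume (fun _ => 1) p u +
    (gradMod volume a q u + powMod volume a q u)

lemma CondD.exists_modular_le_one (hD : CondD N p q a)
    (hr : ∀ x, p x ≤ r x ∧ r x ≤ N * p x / (N - p x))
    (hs : ∀ x, q x ≤ s x ∧ s x ≤ N * q x / (N - q x)) :
    ∃ l : ℝ, 1 ≤ l ∧ ∀ u, IsTest u → sobMod p q a u ≤ 1 →
      powMod volume (fun _ => 1) r (l⁻¹ • u) +
        powMod volume (fun x => a x ^ (s x / q x)) s (l⁻¹ • u) ≤ 1 := by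
  obtain ⟨c, d, B, K, K', L, hp, hq⟩ := hD.exists_exponentWeight
  have hn : (N : ℝ) = Module.finrank ℝ (EuclideanSpace ℝ (Fin N)) := by simp
  have hN : (0 : ℝ) < N := by linarith [hp.one_lt, hp.c_le 0, hp.le_d 0, hp.d_lt]
  have hp1 : ∀ x, 1 < p x := fun x => hp.one_lt.trans_le (hp.c_le x)
  have hpN : ∀ x, p x < N := fun x => (hp.le_d x).trans_lt hp.d_lt
  have hqN := hD.q_lt_N
  have h1 : ∀ _x : EuclideanSpace ℝ (Fin N), (0 : ℝ) ≤ 1 := fun _ => zero_le_one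
  have hpm := hp.lip_m.continuous.measurable
  have hqm := hq.lip_m.continuous.measurable
  have ham := hq.lip_b.continuous.measurable
  set Ap : (EuclideanSpace ℝ (Fin N) → ℝ) → ℝ≥0∞ := fun u =>
    gradMod volume (fun _ => 1) p u + powMod volume (fun _ => 1) p u with hAp
  set Iq : (EuclideanSpace ℝ (Fin N) → ℝ) → ℝ≥0∞ :=
    powMod volume (fun _ => 1) (fun x => N * q x / (N - q x + 1)) with hIq
  set Aq : (EuclideanSpace ℝ (Fin N) → ℝ) → ℝ≥0∞ := fun u =>
    gradMod volume a q u + powMod volume a q u + Iq u with hAq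
  set Xp : (EuclideanSpace ℝ (Fin N) → ℝ) → ℝ≥0∞ :=
    powMod volume (fun _ => 1) (fun x => N * p x / (N - p x)) with hXp
  set Xq : (EuclideanSpace ℝ (Fin N) → ℝ) → ℝ≥0∞ :=
    powMod volume (fun x => a x ^ (N / (N - q x))) (fun x => N * q x / (N - q x)) with hXq
  have sAp : IsShrinking Ap := IsShrinking.add
    (fun l hl u => gradMod_inv_smul_le volume h1 hp.one_le hl u)
    (fun l hl u => powMod_inv_smul_le volume h1 hp.one_le hl u)
  have sR : IsShrinking (sobMod p q a) := sAp.add (IsShrinking.add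
    (fun l hl u => gradMod_inv_smul_le volume hq.b_nonneg hq.one_le hl u)
    (fun l hl u => powMod_inv_smul_le volume hq.b_nonneg hq.one_le hl u))
  have sAq : IsShrinking Aq := IsShrinking.add (IsShrinking.add
    (fun l hl u => gradMod_inv_smul_le volume hq.b_nonneg hq.one_le hl u)
    (fun l hl u => powMod_inv_smul_le volume hq.b_nonneg hq.one_le hl u))
    (fun l hl u => powMod_inv_smul_le volume h1 hq.one_le_intermediate hl u)
  have sXp : IsShrinking Xp := fun l hl u =>
    powMod_inv_smul_le volume h1 hp.one_le_critical hl u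
  have sF : IsShrinking fun u => powMod volume (fun _ => 1) r u +
      powMod volume (fun x => a x ^ (s x / q x)) s u := IsShrinking.add
    (fun l hl u => powMod_inv_smul_le volume h1 (fun x => (hp.one_le x).trans (hr x).1) hl u)
    (fun l hl u => powMod_inv_smul_le volume (fun x => Real.rpow_nonneg (hq.b_nonneg x) _)
      (fun x => (hq.one_le x).trans (hs x).1) hl u)
  obtain ⟨κp, hκp, hXp1⟩ : ∃ κ : ℝ, 0 < κ ∧ ∀ u, IsTest u → Ap u ≤ ENNReal.ofReal κ →
      Xp u ≤ 1 := by
    have := hp.exists_small_imp_powMod_le_one volume hn sAp (fun u => le_rfl) fun δ hδ => by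
      refine ⟨(min δ 1)⁻¹ ^ (N : ℝ), by positivity, fun u hu => ?_⟩
      refine (powMod_intermediate_le volume (lt_min hδ one_pos) (min_le_right _ _) hp1 hpN hpm
        hu.1.continuous.measurable).trans ?_
      simp only [Real.one_rpow]
      gcongr
      · exact min_le_left _ _
      · exact le_add_self
    simpa only [Real.one_rpow] using this
  obtain ⟨κq, hκq, hXq1⟩ : ∃ κ : ℝ, 0 < κ ∧ ∀ u, IsTest u → Aq u ≤ ENNReal.ofReal κ →
      Xq u ≤ 1 :=
    hq.exists_small_imp_powMod_le_one volume hn sAq (fun u => le_self_add) fun δ hδ =>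
      ⟨1, zero_le_one, fun u hu => by
        rw [ENNReal.ofReal_one, one_mul]
        exact le_add_left le_add_self⟩
  have hIq : ∀ u, IsTest u → Iq u ≤ powMod volume (fun _ => 1) p u + Xp u := fun u hu => by
    obtain ⟨R, hR, hqp⟩ := hD.ratio
    refine powMod_le_add volume h1 (fun x => ?_) (fun x => ?_) (fun x => by linarith [hp1 x])
      measurable_const hpm hu.1.continuous.measurable
    · have e1 := hp1 x
      have e2 := hD.p_lt_q x
      have e3 := hqN x
      rw [le_div_iff₀ (by linarith)]
      nlinarith
    · have e1 := hp1 x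
      have e2 := hqN x
      have e3 := hpN x
      have e4 := (hqp x).trans hR.le
      rw [div_le_iff₀ (by linarith)] at e4
      have e5 : N * q x ≤ N * p x + p x := by
        calc N * q x ≤ N * ((1 + 1 / N) * p x) := by gcongr
          _ = _ := by field_simp
      rw [div_le_div_iff₀ (by linarith) (by linarith)]
      nlinarith
  have hF : ∀ u, IsTest u → powMod volume (fun _ => 1) r u +
      powMod volume (fun x => a x ^ (s x / q x)) s u ≤
        powMod volume (fun _ => 1) p u + Xp u + (powMod volume a q u + Xq u) := fun u hu => by
    have hum := hu.1.continuous.measurable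
    refine add_le_add (powMod_le_add volume h1 (fun x => (hr x).1) (fun x => (hr x).2)
      (fun x => by linarith [hp1 x]) measurable_const hpm hum) ?_
    rw [← powMod_rpow_mul volume hq.b_nonneg]
    refine (powMod_le_add volume h1 (fun x => (hs x).1) (fun x => (hs x).2)
      (fun x => by linarith [hq.one_le x]) measurable_const hqm (f := fun x => a x ^ (1 / q x) * u x)
      ((ham.pow (hqm.const_div 1)).mul hum)).trans_eq ?_
    rw [powMod_rpow_mul volume hq.b_nonneg, powMod_rpow_mul volume hq.b_nonneg]
    have e1 : ∀ x, q x / q x = 1 := fun x => div_self (by linarith [hq.one_le x])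
    have e2 : ∀ x, N * q x / (N - q x) / q x = N / (N - q x) := fun x => by
      have : q x ≠ 0 := by linarith [hq.one_le x]
      field_simp
    simp only [e1, e2, Real.rpow_one, hXq]
  obtain ⟨l₁, hl₁, h₁⟩ := sR.exists_le (A := 1) hκp
  obtain ⟨l₂, hl₂, h₂⟩ := sAq.exists_le (A := 2) hκq
  obtain ⟨l₃, hl₃, h₃⟩ := sF.exists_le (A := 3) one_pos
  refine ⟨l₁ * (l₂ * l₃), one_le_mul_of_one_le_of_one_le hl₁
    (one_le_mul_of_one_le_of_one_le hl₂ hl₃), fun u hu hRu => ?_⟩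
  have hv := hu.smul l₁⁻¹
  set v := l₁⁻¹ • u with hv'
  have hw := hv.smul l₂⁻¹
  set w := l₂⁻¹ • v with hw'
  have huw : (l₁ * (l₂ * l₃))⁻¹ • u = l₃⁻¹ • w := by
    rw [hw', hv', smul_smul, smul_smul]
    congr 1
    rw [mul_inv, mul_inv]
    ring
  have hRv : sobMod p q a v ≤ 1 := (sR.le hl₁ u).trans hRu
  have hXv : Xp v ≤ 1 := hXp1 v hv (le_self_add.trans (h₁ u (by simpa using hRu)))
  have hAv : Aq v ≤ ENNReal.ofReal 2 := by
    calc Aq v ≤ gradMod volume a q v + powMod volume a q v +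
          (powMod volume (fun _ => 1) p v + Xp v) := add_le_add le_rfl (hIq v hv)
      _ = powMod volume (fun _ => 1) p v + (gradMod volume a q v + powMod volume a q v) +
          Xp v := by ring
      _ ≤ sobMod p q a v + Xp v := by
          rw [sobMod]; gcongr; exact le_add_self
      _ ≤ 1 + 1 := add_le_add hRv hXv
      _ = ENNReal.ofReal 2 := by norm_num
  have hXqw : Xq w ≤ 1 := hXq1 w hw (h₂ v hAv)
  have hXpw : Xp w ≤ 1 := (sXp.le hl₂ v).trans hXv
  have hRw : sobMod p q a w ≤ 1 := (sR.le hl₂ v).trans hRv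
  rw [huw, ← ENNReal.ofReal_one]
  refine h₃ w ((hF w hw).trans ?_)
  calc powMod volume (fun _ => 1) p w + Xp w + (powMod volume a q w + Xq w)
      = powMod volume (fun _ => 1) p w + powMod volume a q w + Xp w + Xq w := by ring
    _ ≤ sobMod p q a w + Xp w + Xq w := by
        rw [sobMod]
        gcongr
        · exact le_add_self
        · exact le_add_self
    _ ≤ 1 + 1 + 1 := add_le_add (add_le_add hRw hXpw) hXqw
    _ = ENNReal.ofReal 3 := by norm_num

end DoublePhase

lemma norm_gradient {F : Type*} [NormedAddCommGroup F] [InnerProductSpace ℝ F] [CompleteSpace F]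
    (f : F → ℝ) (x : F) : ‖gradient f x‖ = ‖fderiv ℝ f x‖ := by
  rw [gradient, LinearIsometryEquiv.norm_map]

lemma exists_one_le_ae_one_le_mul {X : Type*} [MeasurableSpace X] {μ : Measure X} {f : X → ℝ}
    (hf : 0 < essInf f μ) : ∃ e : ℝ, 1 ≤ e ∧ ∀ᵐ x ∂μ, 1 ≤ f x * e := by
  rw [essInf, liminf_eq] at hf
  have hne : {a : ℝ | ∀ᶠ x in ae μ, a ≤ f x}.Nonempty := by
    by_contra h
    rw [Set.not_nonempty_iff_eq_empty.1 h, Real.sSup_empty] at hf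
    exact lt_irrefl _ hf
  obtain ⟨b, hb, hb0⟩ := exists_lt_of_lt_csSup hne hf
  rw [Set.mem_ofPred_eq] at hb
  refine ⟨max 1 b⁻¹, le_max_left _ _, hb.mono fun x hx => ?_⟩
  calc 1 = b * b⁻¹ := (mul_inv_cancel₀ hb0.ne').symm
    _ ≤ f x * max 1 b⁻¹ := mul_le_mul hx (le_max_right _ _) (by positivity) (hb0.le.trans hx)

section Luxemburg

variable {N : ℕ} {p q a V u : EuclideanSpace ℝ (Fin N) → ℝ}

lemma CondD.Hfun_nonneg (hD : CondD N p q a) (x : EuclideanSpace ℝ (Fin N)) {t : ℝ}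
    (ht : 0 ≤ t) : 0 ≤ Hfun p q a x t := by
  have := hD.a_nonneg x
  rw [Hfun]
  positivity

lemma CondD.one_lt_p (hD : CondD N p q a) (x : EuclideanSpace ℝ (Fin N)) : 1 < p x := by
  obtain ⟨c, hc, h⟩ := hD.inf_p
  exact hc.trans_le (h x)

lemma CondD.Hfun_div_le (hD : CondD N p q a) (x : EuclideanSpace ℝ (Fin N)) {t l : ℝ}
    (ht : 0 ≤ t) (hl : 1 ≤ l) : Hfun p q a x (t / l) ≤ Hfun p q a x t / l := by
  have ha := hD.a_nonneg x
  have hl0 : 0 < l := one_pos.trans_le hl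
  have key : ∀ k : ℝ, 1 ≤ k → (t / l) ^ k ≤ t ^ k / l := fun k hk => by
    rw [Real.div_rpow ht hl0.le]
    refine div_le_div_of_nonneg_left (by positivity) hl0 ?_
    simpa using Real.rpow_le_rpow_of_exponent_le hl hk
  have hp := hD.one_lt_p x
  rw [Hfun, Hfun, add_div, mul_div_assoc]
  gcongr
  · exact key _ hp.le
  · exact key _ (hp.trans (hD.p_lt_q x)).le

lemma CondD.lintegral_Hfun (hD : CondD N p q a) {f : EuclideanSpace ℝ (Fin N) → ℝ}
    (hf : Measurable f) : ∫⁻ x, ENNReal.ofReal (Hfun p q a x |f x|) =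
      powMod volume (fun _ => 1) p f + powMod volume a q f := by
  obtain ⟨K, hK⟩ := hD.lip_p
  have hm : Measurable fun x => ENNReal.ofReal (1 * |f x| ^ p x) :=
    ((hf.abs.pow hK.continuous.measurable).const_mul 1).ennreal_ofReal
  rw [powMod, powMod, ← lintegral_add_left hm]
  refine lintegral_congr fun x => ?_
  have ha := hD.a_nonneg x
  rw [one_mul, ← ENNReal.ofReal_add (by positivity) (by positivity), Hfun]

lemma CondD.measurable_Hfun (hD : CondD N p q a) {f : EuclideanSpace ℝ (Fin N) → ℝ}
    (hf : Measurable f) : Measurable fun x => Hfun p q a x (f x) := by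
  obtain ⟨K, hK⟩ := hD.lip_p
  obtain ⟨K', hK'⟩ := hD.lip_q
  obtain ⟨L, hL⟩ := hD.lip_a
  exact (hf.pow hK.continuous.measurable).add
    (hL.continuous.measurable.mul (hf.pow hK'.continuous.measurable))

lemma CondD.lintegral_eq_sobMod (hD : CondD N p q a) (hu : IsTest u) {τ : ℝ} (hτ : 0 < τ) :
    ∫⁻ x, (ENNReal.ofReal (Hfun p q a x (‖gradient u x‖ / τ)) +
      ENNReal.ofReal (Hfun p q a x (|u x| / τ))) = sobMod p q a (τ⁻¹ • u) := by
  have hm : Measurable (τ⁻¹ • u) := (hu.smul τ⁻¹).1.continuous.measurable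
  have hgm : Measurable fun x => ‖fderiv ℝ (τ⁻¹ • u) x‖ := (measurable_fderiv ℝ _).norm
  have e1 : ∀ x, |u x| / τ = |(τ⁻¹ • u) x| := fun x => by
    rw [Pi.smul_apply, smul_eq_mul, abs_mul, abs_of_pos (inv_pos.2 hτ), inv_mul_eq_div]
  have e2 : ∀ x, ‖gradient u x‖ / τ = |‖fderiv ℝ (τ⁻¹ • u) x‖| := fun x => by
    rw [abs_norm, fderiv_const_smul_field, Pi.smul_apply, norm_smul, norm_gradient,
      Real.norm_of_nonneg (inv_nonneg.2 hτ.le), inv_mul_eq_div]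
  simp only [e1, e2]
  rw [lintegral_add_left (hD.measurable_Hfun hgm.abs).ennreal_ofReal, hD.lintegral_Hfun hgm,
    hD.lintegral_Hfun hm, sobMod, gradMod, gradMod]
  ring

lemma CondD.exists_modular_div_le_one (hD : CondD N p q a) (hV : LocallyIntegrable V volume)
    (hu : IsTest u) : ∃ τ : ℝ, 0 < τ ∧
      (∫⁻ x, (ENNReal.ofReal (Hfun p q a x (‖gradient u x‖ / τ)) +
        ENNReal.ofReal (V x * Hfun p q a x (|u x| / τ)))) ≤ 1 := by
  obtain ⟨K, hK⟩ := hD.lip_p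
  obtain ⟨K', hK'⟩ := hD.lip_q
  obtain ⟨L, hL⟩ := hD.lip_a
  have hp0 : ∀ x, 0 < p x := fun x => one_pos.trans (hD.one_lt_p x)
  have hq0 : ∀ x, 0 < q x := fun x => (hp0 x).trans (hD.p_lt_q x)
  have hgm : Measurable fun x => Hfun p q a x ‖gradient u x‖ := by
    simp only [norm_gradient]
    exact hD.measurable_Hfun (measurable_fderiv ℝ u).norm
  have hg : ∫⁻ x, ENNReal.ofReal (Hfun p q a x ‖gradient u x‖) ≠ ⊤ := by
    have := hD.lintegral_Hfun (measurable_fderiv ℝ u).norm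
    simp only [abs_norm, ← norm_gradient] at this
    rw [this]
    simp only [norm_gradient]
    exact ENNReal.add_ne_top.2
      ⟨gradMod_ne_top volume continuous_const hK.continuous hp0 hu,
        gradMod_ne_top volume hL.continuous hK'.continuous hq0 hu⟩
  have hHc : Continuous fun x => Hfun p q a x |u x| :=
    (hu.1.continuous.abs.rpow hK.continuous fun x => Or.inr (hp0 x)).add
      (hL.continuous.mul (hu.1.continuous.abs.rpow hK'.continuous fun x => Or.inr (hq0 x)))
  have hHs : HasCompactSupport fun x => Hfun p q a x |u x| := hu.2.mono fun x hx h0 => hx (by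
    simp only [Hfun, h0, abs_zero, Real.zero_rpow (hp0 x).ne', Real.zero_rpow (hq0 x).ne',
      mul_zero, add_zero])
  have hVH : Integrable fun x => V x * Hfun p q a x |u x| := by
    simpa only [smul_eq_mul, mul_comm] using
      hV.integrable_smul_left_of_hasCompactSupport hHc hHs
  have hfin : ∫⁻ x, (ENNReal.ofReal (Hfun p q a x ‖gradient u x‖) +
      ENNReal.ofReal (V x * Hfun p q a x |u x|)) ≠ ⊤ := by
    rw [lintegral_add_left hgm.ennreal_ofReal]
    exact ENNReal.add_ne_top.2 ⟨hg, hVH.lintegral_lt_top.ne⟩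
  set I := ∫⁻ x, (ENNReal.ofReal (Hfun p q a x ‖gradient u x‖) +
      ENNReal.ofReal (V x * Hfun p q a x |u x|))
  set τ := max 1 I.toReal
  have hτ1 : 1 ≤ τ := le_max_left _ _
  have hτ0 : 0 < τ := one_pos.trans_le hτ1
  refine ⟨τ, hτ0, ?_⟩
  calc ∫⁻ x, (ENNReal.ofReal (Hfun p q a x (‖gradient u x‖ / τ)) +
        ENNReal.ofReal (V x * Hfun p q a x (|u x| / τ)))
      ≤ ∫⁻ x, ENNReal.ofReal τ⁻¹ * (ENNReal.ofReal (Hfun p q a x ‖gradient u x‖) +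
        ENNReal.ofReal (V x * Hfun p q a x |u x|)) := by
        refine lintegral_mono fun x => ?_
        rw [mul_add, ← ENNReal.ofReal_mul (by positivity), ← ENNReal.ofReal_mul (by positivity)]
        refine add_le_add (ENNReal.ofReal_le_ofReal ?_) ?_
        · rw [inv_mul_eq_div]
          exact hD.Hfun_div_le x (norm_nonneg _) hτ1
        · have hH : 0 ≤ Hfun p q a x (|u x| / τ) := hD.Hfun_nonneg x (by positivity)
          rcases le_total 0 (V x) with hVx | hVx
          · refine ENNReal.ofReal_le_ofReal ?_
            rw [mul_left_comm, inv_mul_eq_div]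
            exact mul_le_mul_of_nonneg_left (hD.Hfun_div_le x (abs_nonneg _) hτ1) hVx
          · rw [ENNReal.ofReal_of_nonpos (mul_nonpos_of_nonpos_of_nonneg hVx hH)]
            exact zero_le
    _ = ENNReal.ofReal τ⁻¹ * I := lintegral_const_mul' _ _ ENNReal.ofReal_ne_top
    _ ≤ 1 := by
        rw [← ENNReal.ofReal_toReal hfin, ← ENNReal.ofReal_mul (by positivity),
          ENNReal.ofReal_le_one, inv_mul_le_iff₀ hτ0, mul_one]
        exact le_max_right _ _

end Luxemburg

/-- **Embedding into Musielak–Orlicz Lebesgue spaces, coercive potential.**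
Under (D) and `ess inf V > 0`, with `p ≤ r ≤ p*`, `q ≤ s ≤ q*` and
`F(x,t) = t^{r(x)} + a(x)^{s(x)/q(x)} t^{s(x)}`, there is `C > 0` with
`‖u‖_{L^F(ℝ^N)} ≤ C ‖u‖_{W^{1,H}(ℝ^N)}` and `‖u‖_{W^{1,H}(ℝ^N)} ≤ C ‖u‖` for all
`u ∈ C_c^∞(ℝ^N)`. -/
theorem stmt16 {N : ℕ} (p q a V : EuclideanSpace ℝ (Fin N) → ℝ) (hD : CondD N p q a)
    (hVloc : LocallyIntegrable V volume)
    (hVinf : 0 < essInf V (volume : Measure (EuclideanSpace ℝ (Fin N))))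
    (r s : EuclideanSpace ℝ (Fin N) → ℝ)
    (hrcont : Continuous r) (hscont : Continuous s)
    (hrbdd : ∃ C : ℝ, ∀ x, r x ≤ C) (hsbdd : ∃ C : ℝ, ∀ x, s x ≤ C)
    (hr : ∀ x, p x ≤ r x ∧ r x ≤ N * p x / (N - p x))
    (hs : ∀ x, q x ≤ s x ∧ s x ≤ N * q x / (N - q x)) :
    ∃ C > (0 : ℝ), ∀ u : EuclideanSpace ℝ (Fin N) → ℝ,
      ContDiff ℝ (⊤ : ℕ∞) u → HasCompactSupport u →
      luxNormOn (fun x t => t ^ r x + a x ^ (s x / q x) * t ^ s x) Set.univ u ≤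
        C * sobNormOn p q a Set.univ u ∧
      sobNormOn p q a Set.univ u ≤ C * VNorm p q a V u := by
  obtain ⟨l, hl, hF⟩ := hD.exists_modular_le_one hr hs
  obtain ⟨e, he, hV⟩ := exists_one_le_ae_one_le_mul hVinf
  have hl0 : 0 < l := one_pos.trans_le hl
  have he0 : 0 < e := one_pos.trans_le he
  refine ⟨max l e, lt_max_of_lt_left hl0, fun u hu hus => ?_⟩
  have hut : IsTest u := ⟨hu, hus⟩
  have hsob : ∀ τ : ℝ, 0 < τ → (∫⁻ x, (ENNReal.ofReal (Hfun p q a x (‖gradient u x‖ / τ)) +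
      ENNReal.ofReal (V x * Hfun p q a x (|u x| / τ)))) ≤ 1 → 0 < e * τ ∧
      (∫⁻ x in Set.univ, (ENNReal.ofReal (Hfun p q a x (‖gradient u x‖ / (e * τ))) +
        ENNReal.ofReal (Hfun p q a x (|u x| / (e * τ))))) ≤ 1 := by
    intro τ hτ h
    refine ⟨by positivity, ?_⟩
    rw [Measure.restrict_univ]
    refine le_trans (lintegral_mono_ae (hV.mono fun x hx => ?_)) h
    have hg : 0 ≤ ‖gradient u x‖ / τ := by positivity
    have hf : 0 ≤ |u x| / τ := by positivity
    rw [mul_comm e τ, ← div_div, ← div_div]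
    have hH : 0 ≤ Hfun p q a x (|u x| / τ) := hD.Hfun_nonneg x hf
    refine add_le_add (ENNReal.ofReal_le_ofReal ((hD.Hfun_div_le x hg he).trans ?_))
      (ENNReal.ofReal_le_ofReal ((hD.Hfun_div_le x hf he).trans ?_))
    · exact div_le_self (hD.Hfun_nonneg x hg) he
    · rw [div_le_iff₀ he0]
      nlinarith
  obtain ⟨τ₀, hτ₀, hτ₀'⟩ := hD.exists_modular_div_le_one hVloc hut
  have hnonneg : 0 ≤ sobNormOn p q a Set.univ u := Real.sInf_nonneg fun τ hτ => hτ.1.le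
  have hnonneg' : 0 ≤ VNorm p q a V u := Real.sInf_nonneg fun τ hτ => hτ.1.le
  constructor
  · refine le_trans ?_ (mul_le_mul_of_nonneg_right (le_max_left l e) hnonneg)
    rw [← div_le_iff₀' hl0]
    refine le_csInf ⟨e * τ₀, hsob τ₀ hτ₀ hτ₀'⟩ fun τ hτ => ?_
    rw [div_le_iff₀' hl0]
    refine csInf_le ⟨0, fun t ht => ht.1.le⟩ ⟨mul_pos hl0 hτ.1, ?_⟩
    have hsm := hτ.2
    rw [Measure.restrict_univ, hD.lintegral_eq_sobMod hut hτ.1] at hsm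
    refine le_trans (le_of_eq ?_) (hF _ (hut.smul τ⁻¹) hsm)
    rw [Measure.restrict_univ, powMod, powMod, ← lintegral_add_left]
    · refine lintegral_congr fun x => ?_
      have ha := hD.a_nonneg x
      rw [one_mul, ← ENNReal.ofReal_add (by positivity) (by positivity), smul_smul,
        Pi.smul_apply, smul_eq_mul, ← mul_inv, inv_mul_eq_div, abs_div,
        abs_of_pos (mul_pos hl0 hτ.1)]
    · have hm : Measurable (l⁻¹ • τ⁻¹ • u) := ((hut.smul τ⁻¹).smul l⁻¹).1.continuous.measurable
      exact ((hm.abs.pow hrcont.measurable).const_mul 1).ennreal_ofReal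
  · refine le_trans ?_ (mul_le_mul_of_nonneg_right (le_max_right l e) hnonneg')
    rw [← div_le_iff₀' he0]
    refine le_csInf ⟨τ₀, hτ₀, hτ₀'⟩ fun τ hτ => ?_
    rw [div_le_iff₀' he0]
    exact csInf_le ⟨0, fun t ht => ht.1.le⟩ (hsob τ hτ.1 hτ.2)
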